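/- Let Φ be a random power-law k-SAT formula with n variables, m ∈ Ω(n) clauses, k ≥ 3, and power-law exponent β > (2k−1)/(k−1), and let Δ = m/n be large enough so that Φ is unsatisfiable with at least constant probability. Let ε, ε₁, ε₂, ε₃ be constants with ε > 0, ε₁ = (k−ε)/2 − 1 > 0, ε₂ = (k−ε)(β−2)/(β−1) − 1 > 0, and 0 < ε₃ < (k/2 − 1)(β−2)/(β−1) − 1. Then asymptotically almost surely the resolution width w of Φ satisfies: (i) if β ∈ ((2k−1)/(k−1), 3) and Δ ∈ o(n^{ε₂}), then w ∈ Ω(n^{ε₂/ε₁} · Δ^{−1/ε₁}); (ii) if β = 3 and Δ ∈ o(n^{ε₁}/log^{1+ε₁} n), then w ∈ Ω(n · Δ^{−1/ε₁} / log^{1+1/ε₁} n); (iii) if β > 3 and Δ ∈ o(n^{ε₁}), then w ∈ Ω(n · Δ^{−1/ε₁}); (iv) if β > (2k−2)/(k−2) and Δ ∈ o(n^{ε₃}/log^{ε₃} n), then w ∈ Ω(n · Δ^{−1/ε₃}). -/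

import Mathlib

open Filter Finset

namespace PLSAT

/-- Weight of variable `i` (0-indexed): variable `i+1` has weight `(i+1)^{-1/(β-1)}`. -/
noncomputable def wt (β : ℝ) {n : ℕ} (i : Fin n) : ℝ :=
  ((i : ℕ) + 1 : ℝ) ^ (-(1 : ℝ) / (β - 1))

noncomputable def totalWt (β : ℝ) (n : ℕ) : ℝ := ∑ i : Fin n, wt β i

/-- A sampled clause: an ordered tuple of `k` variables together with their signs. -/
abbrev Draw (n k : ℕ) := (Fin k → Fin n) × (Fin k → Bool)

/-- A sampled formula: `m` independently sampled clauses. -/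
abbrev Formula (n m k : ℕ) := Fin m → Draw n k

/-- Probability mass of one sampled clause: the `k` distinct variables are drawn
without replacement with probabilities proportional to their weights, and each of
the `k` signs is chosen independently uniformly at random. -/
noncomputable def clauseMass (β : ℝ) {n : ℕ} (k : ℕ) (c : Draw n k) : ℝ :=
  if Function.Injective c.1 then
    (1 / 2) ^ k *
      ∏ j : Fin k,
        wt β (c.1 j) /
          (totalWt β n - ∑ l ∈ Finset.univ.filter (fun l : Fin k => l < j), wt β (c.1 l))
  else 0

/-- Probability mass of a formula: clauses are sampled independently. -/
noncomputable def mass (β : ℝ) {n m k : ℕ} (φ : Formula n m k) : ℝ :=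
  ∏ i : Fin m, clauseMass β k (φ i)

/-- Probability of an event in the power-law random `k`-SAT model. -/
noncomputable def Pr (β : ℝ) (n m k : ℕ) (E : Set (Formula n m k)) : ℝ :=
  ∑ φ : Formula n m k, E.indicator (mass β) φ

def Satisfies {n k : ℕ} (a : Fin n → Bool) (c : Draw n k) : Prop :=
  ∃ j : Fin k, a (c.1 j) = c.2 j

def Unsat {n m k : ℕ} (φ : Formula n m k) : Prop :=
  ¬ ∃ a : Fin n → Bool, ∀ i : Fin m, Satisfies a (φ i)

/-- A resolution clause: a finite set of literals. -/
abbrev RClause (n : ℕ) := Finset (Fin n × Bool)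

def toRClause {n k : ℕ} (c : Draw n k) : RClause n :=
  Finset.image (fun j => (c.1 j, c.2 j)) Finset.univ

def cnf {n m k : ℕ} (φ : Formula n m k) : Set (RClause n) :=
  Set.range fun i : Fin m => toRClause (φ i)

/-- `C` is obtained by resolving `A` and `B` on some variable. -/
def IsResolvent {n : ℕ} (A B C : RClause n) : Prop :=
  ∃ x : Fin n, (x, true) ∈ A ∧ (x, false) ∈ B ∧
    C = A.erase (x, true) ∪ B.erase (x, false)

/-- `L` is a resolution refutation of the clause set `S`. -/
def IsRefutation {n : ℕ} (S : Set (RClause n)) (L : List (RClause n)) : Prop :=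
  (∀ i : Fin L.length, L.get i ∈ S ∨
      ∃ j l : Fin L.length, (j : ℕ) < (i : ℕ) ∧ (l : ℕ) < (i : ℕ) ∧
        IsResolvent (L.get j) (L.get l) (L.get i)) ∧
  (∅ : RClause n) ∈ L

def HasRefutationOfWidth {n : ℕ} (S : Set (RClause n)) (w : ℕ) : Prop :=
  ∃ L : List (RClause n), IsRefutation S L ∧ ∀ C ∈ L, C.card ≤ w

/-- The resolution width of `φ` is at least `b`: every resolution refutation
contains a clause of size at least `b`. -/
def widthAtLeast {n m k : ℕ} (b : ℝ) (φ : Formula n m k) : Prop :=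
  ∀ w : ℕ, HasRefutationOfWidth (cnf φ) w → b ≤ (w : ℝ)

/-- Tree-like resolution derivations: `TreeDeriv S C s` holds if there is a tree-like
resolution derivation of clause `C` from the clause set `S` with `s` nodes. -/
inductive TreeDeriv {n : ℕ} (S : Set (RClause n)) : RClause n → ℕ → Prop
  | ax : ∀ C ∈ S, TreeDeriv S C 1
  | res : ∀ (A B C : RClause n) (sa sb : ℕ), IsResolvent A B C →
      TreeDeriv S A sa → TreeDeriv S B sb → TreeDeriv S C (sa + sb + 1)

/-- The neighborhood of a set of clauses in the clause-variable incidence graph. -/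
def nbhd {n m k : ℕ} (φ : Formula n m k) (Cs : Finset (Fin m)) : Finset (Fin n) :=
  Cs.biUnion fun i => Finset.image (φ i).1 Finset.univ

/-- `G(φ)` is an `(r, c)`-bipartite expander. -/
def IsBipartiteExpander {n m k : ℕ} (φ : Formula n m k) (r : ℕ) (c : ℝ) : Prop :=
  ∀ Cs : Finset (Fin m), Cs.card ≤ r → (1 + c) * (Cs.card : ℝ) ≤ ((nbhd φ Cs).card : ℝ)

/-- The variables occurring in exactly one clause of `Cs`. -/
def uniqueVars {n m k : ℕ} (φ : Formula n m k) (Cs : Finset (Fin m)) : Finset (Fin n) :=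
  (nbhd φ Cs).filter fun v =>
    (Cs.filter fun i => v ∈ Finset.image (φ i).1 Finset.univ).card = 1

end PLSAT

namespace PLSAT

/-- The values taken exactly once by `x`. -/
def onceValues {T V : Type*} [Fintype T] [Fintype V] [DecidableEq V] (x : T → V) : Finset V :=
  Finset.univ.filter fun v => (Finset.univ.filter fun t => x t = v).card = 1

/-- The unnormalised expectation of `θ ^ #(values taken exactly once)` when every slot of `T`
is filled independently according to `p`. -/
noncomputable def onceMoment {V : Type*} [Fintype V] [DecidableEq V] (p : V → ℝ) (θ : ℝ)
    (T : Type*) [Fintype T] [DecidableEq T] : ℝ :=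
  ∑ x : T → V, (∏ t, p (x t)) * θ ^ (onceValues x).card

section Moments

variable {V : Type*} [Fintype V] [DecidableEq V]

theorem onceMoment_congr {T T' : Type*} [Fintype T] [DecidableEq T] [Fintype T'] [DecidableEq T']
    (e : T ≃ T') (p : V → ℝ) (θ : ℝ) : onceMoment p θ T = onceMoment p θ T' := by
  unfold onceMoment
  refine Fintype.sum_equiv (e.arrowCongr (Equiv.refl V)) _ _ fun x => ?_
  congr 1
  · exact Fintype.prod_equiv e _ _ fun t => by simp
  · congr 2
    unfold onceValues
    ext v
    simp only [mem_filter, mem_univ, true_and]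
    rw [Finset.card_bij' (fun t _ => e t) (fun t _ => e.symm t)] <;> simp

theorem sum_prod_fiber_card {T : Type*} [Fintype T] [DecidableEq T] (h : V → ℕ → ℝ) :
    ∑ x : T → V, ∏ v, h v (Finset.univ.filter fun t => x t = v).card =
      ∑ c ∈ (Finset.univ : Finset V).piAntidiag (Fintype.card T),
        (Nat.multinomial Finset.univ c : ℝ) * ∏ v, h v (c v) := by
  let L : MvPolynomial V ℝ →ₗ[ℝ] ℝ :=
    (MvPolynomial.basisMonomials V ℝ).constr ℝ fun c => ∏ v, h v (c v)
  have hL : ∀ c : V →₀ ℕ, L (MvPolynomial.monomial c 1) = ∏ v, h v (c v) := fun c => by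
    have := (MvPolynomial.basisMonomials V ℝ).constr_basis ℝ (fun c => ∏ v, h v (c v)) c
    rwa [MvPolynomial.coe_basisMonomials] at this
  have e1 : (∑ v : V, (MvPolynomial.X v : MvPolynomial V ℝ)) ^ Fintype.card T =
      ∑ x : T → V, ∏ t, MvPolynomial.X (x t) := by
    have := Finset.prod_univ_sum (fun _ : T => (Finset.univ : Finset V))
      (fun _ v => (MvPolynomial.X v : MvPolynomial V ℝ))
    rw [Fintype.piFinset_univ] at this
    rw [← this]; simp
  have e2 := Finset.sum_pow_eq_sum_piAntidiag (Finset.univ : Finset V)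
    (fun v => (MvPolynomial.X v : MvPolynomial V ℝ)) (Fintype.card T)
  rw [e1] at e2
  have e3 := congrArg L e2
  rw [map_sum, map_sum] at e3
  have mono : ∀ c : V → ℕ, ∏ v, (MvPolynomial.X v : MvPolynomial V ℝ) ^ c v =
      MvPolynomial.monomial (Finsupp.equivFunOnFinite.symm c) 1 := fun c => by
    rw [MvPolynomial.monomial_eq, Finsupp.prod_fintype _ _ (by simp)]
    simp
  convert e3 using 2 with x _ c _
  · have : ∏ t, (MvPolynomial.X (x t) : MvPolynomial V ℝ) =
        ∏ v, (MvPolynomial.X v : MvPolynomial V ℝ) ^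
          (Finset.univ.filter fun t => x t = v).card := by
      rw [← Finset.prod_fiberwise (s := Finset.univ) (g := x)]
      refine Finset.prod_congr rfl fun v _ => ?_
      rw [← Finset.prod_const]
      refine Finset.prod_congr rfl fun t ht => ?_
      rw [(Finset.mem_filter.1 ht).2]
    rw [this, mono, hL]
    simp
  · rw [mono, ← nsmul_eq_mul (Nat.multinomial Finset.univ c) (MvPolynomial.monomial _ _),
      map_nsmul, hL, nsmul_eq_mul]
    simp

theorem sum_prod_fiber_card_le {T : Type*} [Fintype T] [DecidableEq T] (h : V → ℕ → ℝ)
    (hh : ∀ v d, 0 ≤ h v d) {z : ℝ} (hz : 0 < z) :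
    ∑ x : T → V, ∏ v, h v (Finset.univ.filter fun t => x t = v).card ≤
      (Fintype.card T).factorial / z ^ Fintype.card T *
        ∏ v, ∑ d ∈ Finset.range (Fintype.card T + 1), h v d * z ^ d / d.factorial := by
  rw [sum_prod_fiber_card, Finset.prod_univ_sum, Finset.mul_sum]
  have key : ∀ c ∈ (Finset.univ : Finset V).piAntidiag (Fintype.card T),
      (Nat.multinomial Finset.univ c : ℝ) * ∏ v, h v (c v) =
      (Fintype.card T).factorial / z ^ Fintype.card T *
        ∏ v, (h v (c v) * z ^ c v / (c v).factorial) := by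
    intro c hc
    have hs : ∑ v, c v = Fintype.card T := (Finset.mem_piAntidiag.1 hc).1
    have hm := Nat.multinomial_spec Finset.univ c
    rw [hs] at hm
    have hpos : (∏ v, ((c v).factorial : ℝ)) ≠ 0 :=
      Finset.prod_ne_zero_iff.2 fun v _ => by positivity
    have hm' : (∏ v, ((c v).factorial : ℝ)) * (Nat.multinomial Finset.univ c : ℝ) =
        (Fintype.card T).factorial := by exact_mod_cast hm
    rw [Finset.prod_div_distrib, Finset.prod_mul_distrib, Finset.prod_pow_eq_pow_sum, hs, ← hm']
    field_simp
  rw [Finset.sum_congr rfl key]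
  refine Finset.sum_le_sum_of_subset_of_nonneg ?_ fun c _ _ => ?_
  · intro c hc
    have hs : ∑ v, c v = Fintype.card T := (Finset.mem_piAntidiag.1 hc).1
    simp only [Fintype.mem_piFinset, Finset.mem_range, Nat.lt_succ_iff]
    exact fun v => hs ▸ Finset.single_le_sum (f := c) (fun _ _ => Nat.zero_le _) (Finset.mem_univ v)
  · have := fun v => hh v (c v)
    exact mul_nonneg (by positivity) (Finset.prod_nonneg fun v _ => by have := this v; positivity)

theorem exp_le_self_add_exp_sq {x : ℝ} (hx : 0 ≤ x) : Real.exp x ≤ x + Real.exp (x ^ 2) := by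
  rcases le_total x 1 with h | h
  · have h1 := (abs_le.1 (Real.abs_exp_sub_one_sub_id_le (x := x) (by rwa [abs_of_nonneg hx]))).2
    have h2 := Real.add_one_le_exp (x ^ 2)
    linarith
  · have : Real.exp x ≤ Real.exp (x ^ 2) := Real.exp_le_exp.2 (by nlinarith)
    linarith

theorem sum_range_once_le {y θ : ℝ} (hy : 0 ≤ y) (hθ : 0 ≤ θ) (N : ℕ) (hN : 1 ≤ N) :
    ∑ d ∈ Finset.range (N + 1), (if d = 1 then θ else 1) * (y ^ d / d.factorial) ≤
      Real.exp (y ^ 2 + θ * y) := by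
  have h1 : ∑ d ∈ Finset.range (N + 1), (if d = 1 then θ else 1) * (y ^ d / d.factorial) =
      ∑ d ∈ Finset.range (N + 1), y ^ d / d.factorial + (θ - 1) * y := by
    have : ∀ d : ℕ, (if d = 1 then θ else 1) * (y ^ d / d.factorial) =
        y ^ d / d.factorial + if d = 1 then (θ - 1) * y else 0 := by
      intro d
      split_ifs with h
      · subst h; simp; ring
      · simp
    simp_rw [this, Finset.sum_add_distrib, Finset.sum_ite_eq']
    rw [if_pos (by simp; omega)]
  have h2 := Real.sum_le_exp_of_nonneg hy (N + 1)
  have h3 := exp_le_self_add_exp_sq hy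
  have h4 := Real.add_one_le_exp (θ * y)
  have h5 : 1 ≤ Real.exp (y ^ 2) := Real.one_le_exp (by positivity)
  have h6 : 0 ≤ θ * y := by positivity
  rw [h1, Real.exp_add]
  nlinarith

/-- A collision bound governed by the second moment of `p`. -/
theorem onceMoment_le_of_sum_sq {T : Type*} [Fintype T] [DecidableEq T] [Nonempty T] {p : V → ℝ}
    (hp : ∀ v, 0 ≤ p v) (hp1 : ∑ v, p v = 1) {θ : ℝ} (hθ : 0 < θ)
    (hθp : Fintype.card T * ∑ v, p v ^ 2 ≤ θ ^ 2) :
    onceMoment p θ T ≤ (Real.exp 2 * θ) ^ Fintype.card T := by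
  set N := Fintype.card T with hN
  have hN1 : 1 ≤ N := Fintype.card_pos
  have hN0 : (0 : ℝ) < N := by exact_mod_cast hN1
  have e1 : ∀ x : T → V, (∏ t, p (x t)) * θ ^ (onceValues x).card =
      ∏ v, (fun (v : V) (d : ℕ) => (if d = 1 then θ else 1) * p v ^ d) v
        (Finset.univ.filter fun t => x t = v).card := by
    intro x
    rw [Finset.prod_mul_distrib, mul_comm]
    congr 1
    · rw [← Finset.prod_filter, Finset.prod_const]; rfl
    · rw [← Finset.prod_fiberwise Finset.univ x]
      refine Finset.prod_congr rfl fun v _ => ?_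
      rw [← Finset.prod_const]
      refine Finset.prod_congr rfl fun t ht => ?_
      rw [(Finset.mem_filter.1 ht).2]
  unfold onceMoment
  simp_rw [e1]
  set z : ℝ := N / θ with hz
  have hz0 : 0 < z := by positivity
  refine (sum_prod_fiber_card_le (T := T)
    (fun (v : V) (d : ℕ) => (if d = 1 then θ else 1) * p v ^ d) (fun v d => ?_) hz0).trans ?_
  · have := hp v
    split_ifs <;> positivity
  have e2 : ∏ v, ∑ d ∈ Finset.range (N + 1),
      (if d = 1 then θ else 1) * p v ^ d * z ^ d / d.factorial ≤ Real.exp (2 * N) := by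
    calc _ ≤ ∏ v, Real.exp ((p v * z) ^ 2 + θ * (p v * z)) := by
          refine Finset.prod_le_prod (fun v _ => Finset.sum_nonneg fun d _ => ?_) fun v _ => ?_
          · have := hp v
            split_ifs <;> positivity
          · have := sum_range_once_le (mul_nonneg (hp v) hz0.le) hθ.le N hN1
            refine le_of_eq_of_le (Finset.sum_congr rfl fun d _ => ?_) this
            rw [mul_pow]; ring
      _ ≤ _ := by
          rw [← Real.exp_sum, Real.exp_le_exp, Finset.sum_add_distrib]
          simp_rw [mul_pow, ← mul_assoc]
          rw [← Finset.sum_mul, ← Finset.sum_mul, ← Finset.mul_sum, hp1]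
          have h1 : θ * 1 * z = N := by rw [hz]; field_simp
          have h2 : (∑ v, p v ^ 2) * z ^ 2 ≤ N := by
            rw [hz, div_pow, mul_div_assoc', div_le_iff₀ (by positivity)]
            nlinarith
          linarith
  refine (mul_le_mul_of_nonneg_left e2 (by positivity)).trans ?_
  rw [← hN]
  have h3 : (N.factorial : ℝ) ≤ (N : ℝ) ^ N := by exact_mod_cast Nat.factorial_le_pow N
  have h4 : Real.exp (2 * N) = Real.exp 2 ^ N := by rw [← Real.exp_nat_mul]; ring_nf
  have h5 : (N.factorial : ℝ) / z ^ N ≤ θ ^ N := by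
    rw [div_le_iff₀ (by positivity), ← mul_pow]
    have : θ * z = N := by rw [hz]; field_simp
    rwa [this]
  rw [h4, mul_pow, mul_comm]
  gcongr

theorem sum_prod_mul_pow_card_image_le {p : V → ℝ} (hp : ∀ v, 0 ≤ p v) (hp1 : ∑ v, p v = 1)
    {q : ℝ} (hq : 0 ≤ q) (N₀ : ℕ)
    (hqp : ∀ A : Finset V, A.card ≤ N₀ → ∑ v ∈ A, p v ≤ q) (N : ℕ) (hN : N ≤ N₀) :
    ∑ x : Fin N → V, (∏ t, p (x t)) * q ^ (Finset.univ.image x).card ≤ (2 * q) ^ N := by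
  induction N with
  | zero => simp
  | succ N ih =>
    rw [← (Fin.consEquiv fun _ => V).sum_comp, Fintype.sum_prod_type_right]
    have step : ∀ x : Fin N → V, ∑ v, (∏ t, p ((Fin.cons v x : Fin (N + 1) → V) t)) *
        q ^ (Finset.univ.image (Fin.cons v x : Fin (N + 1) → V)).card ≤
        2 * q * ((∏ t, p (x t)) * q ^ (Finset.univ.image x).card) := by
      intro x
      set A := Finset.univ.image x with hA
      have hAc : A.card ≤ N₀ := by
        have : A.card ≤ N := by simpa using Finset.card_image_le (s := Finset.univ) (f := x)
        omega
      have himg : ∀ v, Finset.univ.image (Fin.cons v x : Fin (N + 1) → V) = insert v A := by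
        intro v
        ext w
        simp [hA, Fin.exists_fin_succ, eq_comm]
      have hP : 0 ≤ ∏ t, p (x t) := Finset.prod_nonneg fun t _ => hp _
      have hv : ∀ v, p v * q ^ (insert v A).card ≤
          q ^ A.card * (p v * q + if v ∈ A then p v else 0) := by
        intro v
        split_ifs with h
        · rw [Finset.insert_eq_of_mem h]
          have := hp v
          have : 0 ≤ q ^ A.card * (p v * q) := by positivity
          linarith
        · rw [Finset.card_insert_of_notMem h, pow_succ]
          apply le_of_eq
          ring
      calc _ = (∏ t, p (x t)) * ∑ v, p v * q ^ (insert v A).card := by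
            rw [Finset.mul_sum]
            refine Finset.sum_congr rfl fun v _ => ?_
            rw [himg, Fin.prod_univ_succ]
            simp only [Fin.cons_zero, Fin.cons_succ]
            ring
        _ ≤ (∏ t, p (x t)) * (q ^ A.card * (2 * q)) := by
            refine mul_le_mul_of_nonneg_left ?_ hP
            refine (Finset.sum_le_sum fun v _ => hv v).trans ?_
            rw [← Finset.mul_sum, Finset.sum_add_distrib, ← Finset.sum_mul, hp1]
            refine mul_le_mul_of_nonneg_left ?_ (by positivity)
            have := hqp A hAc
            simp only [Finset.sum_ite_mem, Finset.univ_inter]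
            linarith
        _ = _ := by ring
    refine (Finset.sum_le_sum fun x _ => step x).trans ?_
    rw [← Finset.mul_sum, pow_succ, mul_comm]
    exact mul_le_mul_of_nonneg_right (ih (by omega)) (by positivity)

theorem two_mul_card_image_le {T : Type*} [Fintype T] [DecidableEq T] (x : T → V) :
    2 * (Finset.univ.image x).card ≤ Fintype.card T + (onceValues x).card := by
  have h1 : Fintype.card T = ∑ v ∈ Finset.univ.image x,
      (Finset.univ.filter fun t => x t = v).card := by
    rw [← Finset.card_univ]
    exact Finset.card_eq_sum_card_fiberwise fun t _ => by simp
  have h2 : (onceValues x).card = ∑ v ∈ Finset.univ.image x,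
      if (Finset.univ.filter fun t => x t = v).card = 1 then 1 else 0 := by
    rw [← Finset.sum_filter, ← Finset.card_eq_sum_ones]
    congr 1
    ext v
    simp only [onceValues, mem_filter, mem_univ, true_and, mem_image, iff_and_self]
    intro h
    obtain ⟨t, ht⟩ := Finset.card_pos.1 (by rw [h]; exact one_pos)
    exact ⟨t, (Finset.mem_filter.1 ht).2⟩
  rw [h1, h2, ← Finset.sum_add_distrib, mul_comm, ← smul_eq_mul, ← Finset.sum_const]
  refine Finset.sum_le_sum fun v hv => ?_
  obtain ⟨t, -, ht⟩ := Finset.mem_image.1 hv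
  have : 0 < (Finset.univ.filter fun t => x t = v).card :=
    Finset.card_pos.2 ⟨t, by simp [ht]⟩
  split_ifs <;> omega

/-- A collision bound governed by the largest masses of sets of `Fintype.card T` values. -/
theorem onceMoment_le_of_sum_subset {T : Type*} [Fintype T] [DecidableEq T] {p : V → ℝ}
    (hp : ∀ v, 0 ≤ p v) (hp1 : ∑ v, p v = 1) {θ : ℝ} (hθ : 0 < θ) (hθ1 : θ ≤ 1)
    (hθp : ∀ A : Finset V, A.card ≤ Fintype.card T → ∑ v ∈ A, p v ≤ θ ^ 2) :
    onceMoment p θ T ≤ (2 * θ) ^ Fintype.card T := by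
  set N := Fintype.card T with hN
  rw [onceMoment_congr (Fintype.equivFin T)]
  rw [← hN]
  have h1 := sum_prod_mul_pow_card_image_le hp hp1 (by positivity) N hθp N le_rfl
  have h2 : onceMoment p θ (Fin N) * θ ^ N ≤ (2 * θ ^ 2) ^ N := by
    refine le_trans ?_ h1
    unfold onceMoment
    rw [Finset.sum_mul]
    refine Finset.sum_le_sum fun x _ => ?_
    rw [mul_assoc, ← pow_add, ← pow_mul]
    refine mul_le_mul_of_nonneg_left ?_ (Finset.prod_nonneg fun t _ => hp _)
    refine pow_le_pow_of_le_one hθ.le hθ1 ?_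
    have := two_mul_card_image_le x
    rw [Fintype.card_fin] at this
    omega
  have h3 : (2 * θ ^ 2) ^ N = (2 * θ) ^ N * θ ^ N := by rw [← mul_pow]; ring
  rw [h3] at h2
  exact le_of_mul_le_mul_right h2 (by positivity)

end Moments

section Width

variable {n m k : ℕ}

/-- The variable slots of the clauses indexed by `S`, filled according to `φ`. -/
def slotVar (φ : Formula n m k) (S : Finset (Fin m)) (t : S × Fin k) : Fin n :=
  (φ t.1).1 t.2

/-- The clause `C` holds under the assignment `a`. -/
def Holds (a : Fin n → Bool) (C : RClause n) : Prop :=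
  ∃ l ∈ C, a l.1 = l.2

/-- The clauses of `φ` indexed by `S` semantically imply `C`. -/
def Implies (φ : Formula n m k) (S : Finset (Fin m)) (C : RClause n) : Prop :=
  ∀ a : Fin n → Bool, (∀ i ∈ S, Satisfies a (φ i)) → Holds a C

theorem holds_of_isResolvent {A B C : RClause n} (h : IsResolvent A B C) {a : Fin n → Bool}
    (hA : Holds a A) (hB : Holds a B) : Holds a C := by
  obtain ⟨x, -, -, rfl⟩ := h
  obtain ⟨l, hl, hal⟩ := hA
  obtain ⟨l', hl', hal'⟩ := hB
  by_cases h1 : l = (x, true)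
  · by_cases h2 : l' = (x, false)
    · subst h1 h2
      simp_all
    · exact ⟨l', Finset.mem_union_right _ (Finset.mem_erase.2 ⟨h2, hl'⟩), hal'⟩
  · exact ⟨l, Finset.mem_union_left _ (Finset.mem_erase.2 ⟨h1, hl⟩), hal⟩

theorem implies_singleton (φ : Formula n m k) (i : Fin m) : Implies φ {i} (toRClause (φ i)) := by
  intro a ha
  obtain ⟨j, hj⟩ := ha i (by simp)
  exact ⟨((φ i).1 j, (φ i).2 j), Finset.mem_image.2 ⟨j, by simp, rfl⟩, hj⟩

theorem exists_minimal_implies {φ : Formula n m k} {S : Finset (Fin m)} {C : RClause n}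
    (h : Implies φ S C) :
    ∃ S' ⊆ S, Implies φ S' C ∧ ∀ i ∈ S', ¬ Implies φ (S'.erase i) C := by
  induction S using Finset.strongInduction with
  | H S ih =>
    by_cases hm : ∃ i ∈ S, Implies φ (S.erase i) C
    · obtain ⟨i, hi, hC⟩ := hm
      obtain ⟨S', h1, h2⟩ := ih _ (Finset.erase_ssubset hi) hC
      exact ⟨S', h1.trans (Finset.erase_subset _ _), h2⟩
    · push Not at hm
      exact ⟨S, subset_rfl, h, hm⟩

theorem onceValues_subset_of_minimal {φ : Formula n m k} {S : Finset (Fin m)} {C : RClause n}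
    (h : Implies φ S C) (hmin : ∀ i ∈ S, ¬ Implies φ (S.erase i) C) :
    onceValues (slotVar φ S) ⊆ C.image Prod.fst := by
  intro v hv
  obtain ⟨⟨i, j⟩, hij⟩ := Finset.card_eq_one.1 (Finset.mem_filter.1 hv).2
  have hvij : (φ i).1 j = v := by
    have : (i, j) ∈ Finset.univ.filter fun t => slotVar φ S t = v := by rw [hij]; simp
    exact (Finset.mem_filter.1 this).2
  have huniq : ∀ i' : S, ∀ j', (φ i').1 j' = v → i' = i ∧ j' = j := by
    intro i' j' h'
    have : (i', j') ∈ Finset.univ.filter fun t => slotVar φ S t = v :=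
      Finset.mem_filter.2 ⟨Finset.mem_univ _, h'⟩
    rw [hij, Finset.mem_singleton, Prod.mk.injEq] at this
    exact this
  have hni := hmin i i.2
  unfold Implies at hni
  push Not at hni
  obtain ⟨a, ha, haC⟩ := hni
  obtain ⟨l, hl, hal⟩ := h (Function.update a v ((φ i).2 j)) (by
    intro i' hi'
    by_cases hii : i' = i
    · subst hii
      exact ⟨j, by rw [hvij]; simp⟩
    · obtain ⟨j', hj'⟩ := ha i' (Finset.mem_erase.2 ⟨hii, hi'⟩)
      refine ⟨j', ?_⟩
      rw [Function.update_of_ne, hj']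
      intro hc
      exact hii (congrArg Subtype.val (huniq ⟨i', hi'⟩ j' hc).1))
  by_cases hlv : l.1 = v
  · exact Finset.mem_image.2 ⟨l, hl, hlv⟩
  · rw [Function.update_of_ne hlv] at hal
    exact absurd ⟨l, hl, hal⟩ haC

/-- Boundary expansion of all small sets of clauses forces large resolution width. -/
theorem widthAtLeast_of_expansion {φ : Formula n m k} {δ ρ : ℝ} (hδ : 0 < δ) (hρ : 2 ≤ ρ)
    (hexp : ∀ S : Finset (Fin m), S.Nonempty → (S.card : ℝ) ≤ ρ →
      δ * S.card ≤ (onceValues (slotVar φ S)).card) :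
    widthAtLeast (δ * ρ / 2) φ := by
  rintro w ⟨L, ⟨hL, hemp⟩, hw⟩
  by_contra! hlt
  have key : ∀ N : ℕ, ∀ i : Fin L.length, (i : ℕ) = N →
      ∃ S : Finset (Fin m), (S.card : ℝ) ≤ ρ / 2 ∧ Implies φ S (L.get i) := by
    intro N
    induction N using Nat.strong_induction_on with
    | _ N ih =>
      intro i hi
      rcases hL i with ⟨c, hc⟩ | ⟨j, l, hj, hl, hres⟩
      · refine ⟨{c}, by simp; linarith, ?_⟩
        rw [← hc]
        exact implies_singleton φ c
      · obtain ⟨S₁, h₁, hi₁⟩ := ih j (by omega) j rfl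
        obtain ⟨S₂, h₂, hi₂⟩ := ih l (by omega) l rfl
        have himp : Implies φ (S₁ ∪ S₂) (L.get i) := fun a ha =>
          holds_of_isResolvent hres
            (hi₁ a fun i hi => ha i (Finset.mem_union_left _ hi))
            (hi₂ a fun i hi => ha i (Finset.mem_union_right _ hi))
        obtain ⟨S, hS, hSi, hmin⟩ := exists_minimal_implies himp
        refine ⟨S, ?_, hSi⟩
        by_contra! hbig
        have hcard : (S.card : ℝ) ≤ ρ := by
          have : (S.card : ℝ) ≤ S₁.card + S₂.card := by
            exact_mod_cast (Finset.card_le_card hS).trans (Finset.card_union_le _ _)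
          linarith
        have hne : S.Nonempty := by
          rw [← Finset.card_pos]
          have : (0 : ℝ) < S.card := by linarith
          exact_mod_cast this
        have h3 := hexp S hne hcard
        have h4 : (onceValues (slotVar φ S)).card ≤ w :=
          ((Finset.card_le_card (onceValues_subset_of_minimal hSi hmin)).trans
            Finset.card_image_le).trans (hw _ (List.get_mem _ _))
        have h5 : ((onceValues (slotVar φ S)).card : ℝ) ≤ w := by exact_mod_cast h4
        nlinarith
  obtain ⟨i, hi⟩ := List.get_of_mem hemp
  obtain ⟨S₀, hS₀, himp⟩ := key i i rfl
  rw [hi] at himp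
  obtain ⟨S, hS, hSi, hmin⟩ := exists_minimal_implies himp
  rcases S.eq_empty_or_nonempty with rfl | hne
  · obtain ⟨l, hl, -⟩ := hSi (fun _ => true) (by simp)
    simp at hl
  · have hcard : (S.card : ℝ) ≤ S₀.card := by exact_mod_cast Finset.card_le_card hS
    have h3 := hexp S hne (by linarith)
    have h4 := Finset.card_le_card (onceValues_subset_of_minimal hSi hmin)
    simp only [Finset.image_empty, Finset.card_empty, Nat.le_zero] at h4
    rw [h4] at h3
    have : (0 : ℝ) < S.card := by exact_mod_cast hne.card_pos
    have : 0 < δ * S.card := by positivity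
    simp at h3
    linarith

end Width

section Probability

variable {β : ℝ} {n m k : ℕ}

/-- The probability of drawing variable `i` first. -/
noncomputable def drawProb (β : ℝ) (n : ℕ) (i : Fin n) : ℝ :=
  wt β i / totalWt β n

theorem wt_pos (i : Fin n) : 0 < wt β i := by unfold wt; positivity

theorem wt_le_one (hβ : 1 < β) (i : Fin n) : wt β i ≤ 1 := by
  unfold wt
  refine Real.rpow_le_one_of_one_le_of_nonpos ?_ ?_
  · have : (0 : ℝ) ≤ (i : ℕ) := by positivity
    linarith
  · exact div_nonpos_of_nonpos_of_nonneg (by norm_num) (by linarith)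

theorem sum_filter_wt_le (hβ : 1 < β) (x : Fin k → Fin n) (P : Fin k → Prop) [DecidablePred P] :
    ∑ l ∈ Finset.univ.filter P, wt β (x l) ≤ k := by
  calc _ ≤ ∑ l ∈ Finset.univ.filter P, (1 : ℝ) := Finset.sum_le_sum fun l _ => wt_le_one hβ _
    _ ≤ k := by
      simp only [Finset.sum_const, nsmul_eq_mul, mul_one]
      exact_mod_cast (Finset.card_le_univ _).trans (by simp)

theorem totalWt_pos_of_le (hk : 0 < k) (hW : 2 * (k : ℝ) ≤ totalWt β n) : 0 < totalWt β n := by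
  have : (0 : ℝ) < k := by exact_mod_cast hk
  linarith

theorem drawProb_nonneg (i : Fin n) : 0 ≤ drawProb β n i :=
  div_nonneg (wt_pos i).le (Finset.sum_nonneg fun j _ => (wt_pos j).le)

theorem sum_drawProb (hW : 0 < totalWt β n) : ∑ i, drawProb β n i = 1 := by
  unfold drawProb
  rw [← Finset.sum_div]
  exact div_self hW.ne'

theorem clauseMass_nonneg (hβ : 1 < β) (hW : 2 * (k : ℝ) ≤ totalWt β n) (c : Draw n k) :
    0 ≤ clauseMass β k c := by
  unfold clauseMass
  split_ifs
  · refine mul_nonneg (by positivity) (Finset.prod_nonneg fun j _ => ?_)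
    refine div_nonneg (wt_pos _).le ?_
    have := sum_filter_wt_le hβ c.1 (· < j)
    have : (0 : ℝ) ≤ k := by positivity
    linarith
  · exact le_rfl

theorem clauseMass_le (hβ : 1 < β) (hk : 0 < k) (hW : 2 * (k : ℝ) ≤ totalWt β n)
    (c : Draw n k) : clauseMass β k c ≤ ∏ j, drawProb β n (c.1 j) := by
  have hW0 := totalWt_pos_of_le hk hW
  unfold clauseMass
  split_ifs
  · have h2 : ((1 : ℝ) / 2) ^ k = ∏ _j : Fin k, (1 / 2 : ℝ) := by simp
    rw [h2, ← Finset.prod_mul_distrib]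
    have hden : ∀ j : Fin k, totalWt β n / 2 ≤
        totalWt β n - ∑ l ∈ Finset.univ.filter (fun l : Fin k => l < j), wt β (c.1 l) := by
      intro j
      have := sum_filter_wt_le hβ c.1 (· < j)
      linarith
    refine Finset.prod_le_prod (fun j _ => ?_) fun j _ => ?_
    · have := hden j
      exact mul_nonneg (by norm_num) (div_nonneg (wt_pos _).le (by linarith))
    · have h3 : wt β (c.1 j) / (totalWt β n -
          ∑ l ∈ Finset.univ.filter (fun l : Fin k => l < j), wt β (c.1 l)) ≤
          wt β (c.1 j) / (totalWt β n / 2) :=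
        div_le_div_of_nonneg_left (wt_pos _).le (by positivity) (hden j)
      unfold drawProb
      calc _ ≤ 1 / 2 * (wt β (c.1 j) / (totalWt β n / 2)) := by gcongr
        _ = _ := by field_simp
  · exact Finset.prod_nonneg fun j _ => drawProb_nonneg _

theorem sum_sequential_draws (hβ : 1 < β) (hW : 2 * (k : ℝ) ≤ totalWt β n) (K : ℕ) (hK : K ≤ k) :
    ∑ x : Fin K → Fin n, (if Function.Injective x then
      ∏ j : Fin K, wt β (x j) /
        (totalWt β n - ∑ l ∈ Finset.univ.filter (fun l : Fin K => l < j), wt β (x l)) else 0)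
      = 1 := by
  induction K with
  | zero => simp [Function.injective_of_subsingleton]
  | succ K ih =>
    rw [← (Fin.snocEquiv fun _ => Fin n).sum_comp, Fintype.sum_prod_type_right]
    rw [← ih (by omega)]
    refine Finset.sum_congr rfl fun x _ => ?_
    by_cases hx : Function.Injective x
    swap
    · rw [if_neg hx]
      refine Finset.sum_eq_zero fun v _ => if_neg fun h => hx ?_
      exact (Fin.snoc_injective_iff.1 h).1
    rw [if_pos hx]
    have hfil : ∀ v : Fin n, ∀ j : Fin (K + 1),
        ∑ l ∈ Finset.univ.filter (fun l : Fin (K + 1) => l < j),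
          wt β ((Fin.snoc x v : Fin (K + 1) → Fin n) l) =
        ∑ l : Fin K, if l.castSucc < j then wt β (x l) else 0 := by
      intro v j
      rw [Finset.sum_filter, Fin.sum_univ_castSucc]
      simp [Fin.le_last]
    set D := totalWt β n - ∑ l : Fin K, wt β (x l) with hD
    have hD0 : D ≠ 0 := by
      have h1 := sum_filter_wt_le hβ x (fun _ => True)
      simp only [Finset.filter_true] at h1
      have h2 : (K : ℝ) + 1 ≤ k := by exact_mod_cast hK
      have h3 : (0 : ℝ) ≤ K := by positivity
      have : 0 < D := by rw [hD]; linarith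
      exact this.ne'
    have hterm : ∀ v : Fin n,
        (if Function.Injective (Fin.snoc x v : Fin (K + 1) → Fin n) then
          ∏ j : Fin (K + 1), wt β ((Fin.snoc x v : Fin (K + 1) → Fin n) j) /
            (totalWt β n - ∑ l ∈ Finset.univ.filter (fun l : Fin (K + 1) => l < j),
              wt β ((Fin.snoc x v : Fin (K + 1) → Fin n) l)) else 0) =
        (∏ j : Fin K, wt β (x j) /
          (totalWt β n - ∑ l ∈ Finset.univ.filter (fun l : Fin K => l < j), wt β (x l))) *
          ((if v ∈ Finset.univ.image x then 0 else wt β v) / D) := by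
      intro v
      by_cases hv : v ∈ Finset.univ.image x
      · rw [if_pos hv, if_neg]
        · simp
        · intro h
          refine (Fin.snoc_injective_iff.1 h).2 ?_
          simpa using hv
      · rw [if_neg hv, if_pos, Fin.prod_univ_castSucc]
        · simp only [hfil, Fin.snoc_castSucc, Fin.snoc_last, Fin.castSucc_lt_last, if_true,
            Fin.castSucc_lt_castSucc_iff]
          simp only [Finset.sum_filter]
          rw [hD]
        · refine Fin.snoc_injective_iff.2 ⟨hx, ?_⟩
          simpa using hv
    refine (Finset.sum_congr rfl fun v _ => hterm v).trans ?_
    rw [← Finset.mul_sum, ← Finset.sum_div]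
    have hsum : ∑ v, (if v ∈ Finset.univ.image x then 0 else wt β v) = D := by
      have h1 : ∀ v : Fin n, (if v ∈ Finset.univ.image x then 0 else wt β v) =
          wt β v - if v ∈ Finset.univ.image x then wt β v else 0 := by
        intro v
        split_ifs <;> simp
      simp_rw [h1, Finset.sum_sub_distrib]
      rw [Finset.sum_ite_mem, Finset.univ_inter, Finset.sum_image fun a _ b _ h => hx h]
      rfl
    rw [hsum, div_self hD0, mul_one]

theorem sum_clauseMass (hβ : 1 < β) (hW : 2 * (k : ℝ) ≤ totalWt β n) :
    ∑ c : Draw n k, clauseMass β k c = 1 := by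
  rw [Fintype.sum_prod_type, ← sum_sequential_draws hβ hW k le_rfl]
  refine Finset.sum_congr rfl fun x _ => ?_
  unfold clauseMass
  simp only [Finset.sum_const, Finset.card_univ, Fintype.card_fun, Fintype.card_bool,
    Fintype.card_fin, nsmul_eq_mul]
  split_ifs
  · push_cast
    rw [← mul_assoc, ← mul_pow]
    norm_num
  · simp

theorem sum_mass (hβ : 1 < β) (hW : 2 * (k : ℝ) ≤ totalWt β n) :
    ∑ φ : Formula n m k, mass β φ = 1 := by
  have := Finset.prod_univ_sum (fun _ : Fin m => (Finset.univ : Finset (Draw n k)))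
    (fun _ c => clauseMass β k c)
  rw [Fintype.piFinset_univ] at this
  unfold mass
  rw [← this]
  simp [sum_clauseMass hβ hW]

theorem mass_nonneg (hβ : 1 < β) (hW : 2 * (k : ℝ) ≤ totalWt β n) (φ : Formula n m k) :
    0 ≤ mass β φ :=
  Finset.prod_nonneg fun _ _ => clauseMass_nonneg hβ hW _

theorem Pr_compl (hβ : 1 < β) (hW : 2 * (k : ℝ) ≤ totalWt β n) (E : Set (Formula n m k)) :
    Pr β n m k Eᶜ = 1 - Pr β n m k E := by
  unfold Pr
  rw [← sum_mass (m := m) hβ hW, ← Finset.sum_sub_distrib]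
  refine Finset.sum_congr rfl fun φ _ => ?_
  by_cases h : φ ∈ E <;> simp [h]

theorem Pr_le_one (hβ : 1 < β) (hW : 2 * (k : ℝ) ≤ totalWt β n) (E : Set (Formula n m k)) :
    Pr β n m k E ≤ 1 := by
  rw [← sum_mass (m := m) hβ hW]
  exact Finset.sum_le_sum fun φ _ => Set.indicator_le_self' (fun _ _ => mass_nonneg hβ hW _) φ

/-- The expectation of a function of the variables in the clauses indexed by `S` is controlled by
independent draws with replacement. -/
theorem sum_mass_mul_slotVar_le (hβ : 1 < β) (hk : 0 < k) (hW : 2 * (k : ℝ) ≤ totalWt β n)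
    (S : Finset (Fin m)) (G : (S × Fin k → Fin n) → ℝ) (hG : ∀ x, 0 ≤ G x) :
    ∑ φ : Formula n m k, mass β φ * G (slotVar φ S) ≤
      2 ^ (k * S.card) * ∑ x : S × Fin k → Fin n, (∏ t, drawProb β n (x t)) * G x := by
  have h1 : ∑ φ : Formula n m k, mass β φ * G (slotVar φ S) =
      ∑ ψ : S → Draw n k, (∏ i, clauseMass β k (ψ i)) * G fun t => (ψ t.1).1 t.2 := by
    rw [← (Equiv.piEquivPiSubtypeProd (fun i : Fin m => i ∈ S)
      (fun _ => Draw n k)).symm.sum_comp, Fintype.sum_prod_type]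
    refine Finset.sum_congr rfl fun ψ _ => ?_
    have h2 : ∀ χ : {i // ¬ i ∈ S} → Draw n k,
        mass β ((Equiv.piEquivPiSubtypeProd (fun i : Fin m => i ∈ S)
          (fun _ => Draw n k)).symm (ψ, χ)) *
        G (slotVar ((Equiv.piEquivPiSubtypeProd (fun i : Fin m => i ∈ S)
          (fun _ => Draw n k)).symm (ψ, χ)) S) =
        ((∏ i, clauseMass β k (ψ i)) * G fun t => (ψ t.1).1 t.2) *
          ∏ i, clauseMass β k (χ i) := by
      intro χ
      have h3 : slotVar ((Equiv.piEquivPiSubtypeProd (fun i : Fin m => i ∈ S)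
          (fun _ => Draw n k)).symm (ψ, χ)) S = fun t => (ψ t.1).1 t.2 := by
        funext t
        simp [slotVar, Equiv.piEquivPiSubtypeProd]
      rw [h3]
      unfold mass
      rw [← Fintype.prod_subtype_mul_prod_subtype (fun i => i ∈ S)]
      have h4 : ∀ i : {i // i ∈ S}, (Equiv.piEquivPiSubtypeProd (fun i : Fin m => i ∈ S)
          (fun _ => Draw n k)).symm (ψ, χ) i = ψ i := by
        intro i; simp [Equiv.piEquivPiSubtypeProd]
      have h5 : ∀ i : {i // ¬ i ∈ S}, (Equiv.piEquivPiSubtypeProd (fun i : Fin m => i ∈ S)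
          (fun _ => Draw n k)).symm (ψ, χ) i = χ i := by
        intro i; simp [Equiv.piEquivPiSubtypeProd, i.2]
      simp_rw [h4, h5]
      rw [mul_right_comm]
      congr!
    rw [Finset.sum_congr rfl fun χ _ => h2 χ, ← Finset.mul_sum]
    have h6 := Finset.prod_univ_sum
      (fun _ : {i // ¬ i ∈ S} => (Finset.univ : Finset (Draw n k)))
      (fun _ c => clauseMass β k c)
    rw [Fintype.piFinset_univ] at h6
    rw [← h6]
    simp [sum_clauseMass hβ hW]
  rw [h1]
  have h2 : ∑ ψ : S → Draw n k, (∏ i, clauseMass β k (ψ i)) * (G fun t => (ψ t.1).1 t.2) ≤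
      ∑ ψ : S → Draw n k, (∏ i, ∏ j, drawProb β n ((ψ i).1 j)) * G fun t => (ψ t.1).1 t.2 := by
    refine Finset.sum_le_sum fun ψ _ => mul_le_mul_of_nonneg_right ?_ (hG _)
    exact Finset.prod_le_prod (fun i _ => clauseMass_nonneg hβ hW _)
      fun i _ => clauseMass_le hβ hk hW _
  refine h2.trans (le_of_eq ?_)
  rw [← (Equiv.arrowProdEquivProdArrow S (fun _ => Fin k → Fin n)
    (fun _ => Fin k → Bool)).symm.sum_comp, Fintype.sum_prod_type]
  simp only [Equiv.arrowProdEquivProdArrow_symm_apply, Finset.sum_const, Finset.card_univ,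
    Fintype.card_fun, Fintype.card_bool, Fintype.card_fin, nsmul_eq_mul, Fintype.card_coe]
  rw [← Finset.mul_sum, ← pow_mul]
  push_cast
  congr 1
  rw [← (Equiv.curry S (Fin k) (Fin n)).sum_comp]
  refine Finset.sum_congr rfl fun x _ => ?_
  congr 1
  rw [Fintype.prod_prod_type]
  rfl

end Probability

section UnionBound

variable {β : ℝ} {n m k : ℕ}

/-- The formulas in which the clauses indexed by `S` have few boundary slots. -/
def poorBoundary (δ : ℝ) (n m k : ℕ) (S : Finset (Fin m)) : Set (Formula n m k) :=
  {φ | ((onceValues (slotVar φ S)).card : ℝ) < δ * S.card}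

theorem Pr_poorBoundary_le (hβ : 1 < β) (hk : 0 < k) (hW : 2 * (k : ℝ) ≤ totalWt β n)
    {δ θ M : ℝ} (hθ : 0 < θ) (hθ1 : θ ≤ 1) (S : Finset (Fin m))
    (hM : onceMoment (drawProb β n) θ (S × Fin k) ≤ M) :
    Pr β n m k (poorBoundary δ n m k S) ≤
      2 ^ (k * S.card) * M * θ ^ (-(δ * S.card)) := by
  have h1 : Pr β n m k (poorBoundary δ n m k S) ≤
      ∑ φ : Formula n m k, mass β φ *
        (fun x => θ ^ (onceValues x).card * θ ^ (-(δ * S.card))) (slotVar φ S) := by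
    refine Finset.sum_le_sum fun φ _ => ?_
    have hm := mass_nonneg (m := m) hβ hW φ
    by_cases h : φ ∈ poorBoundary δ n m k S
    · rw [Set.indicator_of_mem h]
      refine le_mul_of_one_le_right hm ?_
      simp only
      rw [← Real.rpow_natCast, ← Real.rpow_add hθ]
      refine Real.one_le_rpow_of_pos_of_le_one_of_nonpos hθ hθ1 ?_
      have : ((onceValues (slotVar φ S)).card : ℝ) < δ * S.card := h
      linarith
    · rw [Set.indicator_of_notMem h]
      positivity
  refine h1.trans ((sum_mass_mul_slotVar_le hβ hk hW S
    (fun x => θ ^ (onceValues x).card * θ ^ (-(δ * S.card))) fun x => by positivity).trans ?_)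
  simp_rw [← mul_assoc]
  rw [← Finset.sum_mul, ← mul_assoc]
  exact mul_le_mul_of_nonneg_right (mul_le_mul_of_nonneg_left hM (by positivity)) (by positivity)

theorem one_sub_sum_le_Pr_widthAtLeast (hβ : 1 < β) (hW : 2 * (k : ℝ) ≤ totalWt β n)
    {δ ρ : ℝ} (hδ : 0 < δ) (hρ : 2 ≤ ρ) {f : ℕ → ℝ} (hf0 : ∀ s, 0 ≤ f s)
    (hf : ∀ S : Finset (Fin m), S.Nonempty → (S.card : ℝ) ≤ ρ →
      Pr β n m k (poorBoundary δ n m k S) ≤ f S.card) :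
    1 - ∑ s ∈ Finset.Icc 1 ⌊ρ⌋₊, (m.choose s : ℝ) * f s ≤
      Pr β n m k {φ | widthAtLeast (δ * ρ / 2) φ} := by
  have h0 := Pr_compl (m := m) hβ hW {φ : Formula n m k | widthAtLeast (δ * ρ / 2) φ}
  have h1 : Pr β n m k {φ | widthAtLeast (δ * ρ / 2) φ}ᶜ ≤
      ∑ S : Finset (Fin m), if S.card ∈ Finset.Icc 1 ⌊ρ⌋₊ then f S.card else 0 := by
    calc _ ≤ ∑ φ : Formula n m k, ∑ S : Finset (Fin m), (if S.card ∈ Finset.Icc 1 ⌊ρ⌋₊ then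
            (poorBoundary δ n m k S).indicator (mass β) φ else 0) := by
          refine Finset.sum_le_sum fun φ _ => ?_
          have hm := mass_nonneg (m := m) hβ hW φ
          have hterm : ∀ S : Finset (Fin m), 0 ≤ (if S.card ∈ Finset.Icc 1 ⌊ρ⌋₊ then
            (poorBoundary δ n m k S).indicator (mass β) φ else 0) := by
            intro S
            split_ifs
            · exact Set.indicator_nonneg (fun φ _ => mass_nonneg hβ hW φ) φ
            · exact le_rfl
          by_cases h : widthAtLeast (δ * ρ / 2) φ
          · rw [Set.indicator_of_notMem (by simpa using h)]
            exact Finset.sum_nonneg fun S _ => hterm S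
          · rw [Set.indicator_of_mem h]
            obtain ⟨S, hS, hSρ, hSb⟩ : ∃ S : Finset (Fin m), S.Nonempty ∧ (S.card : ℝ) ≤ ρ ∧
                ((onceValues (slotVar φ S)).card : ℝ) < δ * S.card := by
              by_contra! hcon
              exact h (widthAtLeast_of_expansion hδ hρ hcon)
            have hmem : S.card ∈ Finset.Icc 1 ⌊ρ⌋₊ :=
              Finset.mem_Icc.2 ⟨hS.card_pos, Nat.le_floor hSρ⟩
            have := Finset.single_le_sum (fun S _ => hterm S) (Finset.mem_univ S)
            refine le_trans (le_of_eq ?_) this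
            simp only [if_pos hmem]
            rw [Set.indicator_of_mem (show φ ∈ poorBoundary δ n m k S from hSb)]
      _ ≤ _ := by
          rw [Finset.sum_comm]
          refine Finset.sum_le_sum fun S _ => ?_
          split_ifs with h
          · rw [Finset.mem_Icc] at h
            refine hf S (Finset.card_pos.1 h.1) ?_
            exact (Nat.le_floor_iff (by linarith)).1 h.2
          · simp
  have h2 : ∑ S : Finset (Fin m), (if S.card ∈ Finset.Icc 1 ⌊ρ⌋₊ then f S.card else 0) ≤
      ∑ s ∈ Finset.Icc 1 ⌊ρ⌋₊, (m.choose s : ℝ) * f s := by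
    have := Finset.sum_powerset_apply_card (fun s => if s ∈ Finset.Icc 1 ⌊ρ⌋₊ then f s else 0)
      (x := (Finset.univ : Finset (Fin m)))
    rw [Finset.powerset_univ] at this
    rw [this]
    simp only [nsmul_eq_mul, mul_ite, mul_zero, Finset.card_univ, Fintype.card_fin]
    rw [Finset.sum_ite_mem]
    exact Finset.sum_le_sum_of_subset_of_nonneg Finset.inter_subset_right
      fun s _ _ => mul_nonneg (by positivity) (hf0 s)
  linarith

theorem choose_le_exp_one_mul_div_pow (m s : ℕ) (hs : 1 ≤ s) :
    (m.choose s : ℝ) ≤ (Real.exp 1 * (m / s)) ^ s := by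
  have hs0 : (0 : ℝ) < s := by exact_mod_cast hs
  have h1 : (m.choose s : ℝ) ≤ (m : ℝ) ^ s / s.factorial := Nat.choose_le_pow_div s m
  have h2 := Real.pow_div_factorial_le_exp (s : ℝ) hs0.le s
  have h3 : Real.exp s = Real.exp 1 ^ s := by rw [← Real.exp_nat_mul]; ring_nf
  rw [h3] at h2
  refine h1.trans ?_
  rw [mul_pow, div_pow]
  have h4 : (m : ℝ) ^ s / s.factorial =
      ((s : ℝ) ^ s / s.factorial) * ((m : ℝ) ^ s / (s : ℝ) ^ s) := by
    field_simp
  rw [h4]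
  gcongr

theorem rpow_one_sub_le_totalWt (hβ : 2 < β) (hn : 1 ≤ n) :
    (n : ℝ) ^ (1 - 1 / (β - 1)) ≤ totalWt β n := by
  have hn0 : (0 : ℝ) < n := by exact_mod_cast hn
  have h1 : ∑ _i : Fin n, (n : ℝ) ^ (-(1 : ℝ) / (β - 1)) ≤ totalWt β n := by
    refine Finset.sum_le_sum fun i _ => ?_
    unfold wt
    refine Real.rpow_le_rpow_of_nonpos (by positivity) ?_ ?_
    · exact_mod_cast i.2
    · exact div_nonpos_of_nonpos_of_nonneg (by norm_num) (by linarith)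
  refine le_trans (le_of_eq ?_) h1
  rw [Finset.sum_const, Finset.card_univ, Fintype.card_fin, nsmul_eq_mul, sub_eq_add_neg,
    Real.rpow_add hn0, Real.rpow_one, neg_div]

theorem rpow_exponent_pos (hβ : 2 < β) : 0 < 1 - 1 / (β - 1) := by
  rw [sub_pos, div_lt_one (by linarith)]
  linarith

theorem eventually_le_totalWt (hβ : 2 < β) (b : ℝ) :
    ∀ᶠ n : ℕ in atTop, b ≤ totalWt β n := by
  have h := (tendsto_rpow_atTop (rpow_exponent_pos hβ)).comp tendsto_natCast_atTop_atTop
  filter_upwards [h.eventually_ge_atTop b, eventually_ge_atTop 1] with n hn h1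
  exact hn.trans (rpow_one_sub_le_totalWt hβ h1)

theorem choose_mul_moment_le {K θ δ B : ℝ} (hK : 0 < K) (hθ : 0 < θ) {s : ℕ} (hs : 1 ≤ s)
    (hB : (m : ℝ) / s * θ ^ ((k : ℝ) - δ) ≤ B) :
    (m.choose s : ℝ) * (2 ^ (k * s) * (K * θ) ^ (k * s) * θ ^ (-(δ * s))) ≤
      (Real.exp 1 * (2 * K) ^ k * B) ^ s := by
  have h1 := choose_le_exp_one_mul_div_pow m s hs
  have h2 : (2 : ℝ) ^ (k * s) * (K * θ) ^ (k * s) * θ ^ (-(δ * s)) =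
      ((2 * K) ^ k * θ ^ ((k : ℝ) - δ)) ^ s := by
    rw [mul_pow, mul_pow ((2 * K) ^ k), ← Real.rpow_mul_natCast hθ.le, sub_mul, sub_eq_add_neg,
      Real.rpow_add hθ, ← pow_mul, mul_pow 2 K]
    have : θ ^ ((k : ℝ) * s) = θ ^ (k * s) := by exact_mod_cast Real.rpow_natCast θ (k * s)
    rw [this]
    ring
  rw [h2]
  calc _ ≤ (Real.exp 1 * (m / s)) ^ s * ((2 * K) ^ k * θ ^ ((k : ℝ) - δ)) ^ s := by gcongr
    _ = (Real.exp 1 * (2 * K) ^ k * ((m : ℝ) / s * θ ^ ((k : ℝ) - δ))) ^ s := by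
      rw [← mul_pow]; ring
    _ ≤ _ := by gcongr

theorem sum_Icc_pow_self_le {a D R ρ : ℝ} (ha : 0 < a) (hD : 0 < D) (hR : 0 < R)
    (hρ : D * (ρ / R) ^ a ≤ 1 / 2) (hρ0 : 0 ≤ ρ) :
    ∑ s ∈ Finset.Icc 1 ⌊ρ⌋₊, (D * ((s : ℝ) / R) ^ a) ^ s ≤
      2 * D * (∑' s : ℕ, (s : ℝ) ^ ⌈a⌉₊ * (1 / 2) ^ s) * R ^ (-a) := by
  have hsum : Summable fun s : ℕ => (s : ℝ) ^ ⌈a⌉₊ * (1 / 2 : ℝ) ^ s :=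
    summable_pow_mul_geometric_of_norm_lt_one _ (by norm_num)
  have h1 : ∀ s ∈ Finset.Icc 1 ⌊ρ⌋₊, (D * ((s : ℝ) / R) ^ a) ^ s ≤
      2 * D * R ^ (-a) * ((s : ℝ) ^ ⌈a⌉₊ * (1 / 2) ^ s) := by
    intro s hs
    rw [Finset.mem_Icc] at hs
    have hsρ : (s : ℝ) ≤ ρ := (Nat.le_floor_iff hρ0).1 hs.2
    have hs1 : (1 : ℝ) ≤ s := by exact_mod_cast hs.1
    have hb : D * ((s : ℝ) / R) ^ a ≤ 1 / 2 := by
      refine le_trans ?_ hρ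
      gcongr
    have hb0 : 0 ≤ D * ((s : ℝ) / R) ^ a := by positivity
    obtain ⟨j, rfl⟩ : ∃ j, s = j + 1 := ⟨s - 1, by omega⟩
    rw [pow_succ, pow_succ (1 / 2 : ℝ)]
    have h2 : (((j + 1 : ℕ) : ℝ)) ^ a ≤ (((j + 1 : ℕ) : ℝ)) ^ ⌈a⌉₊ := by
      rw [← Real.rpow_natCast]
      exact Real.rpow_le_rpow_of_exponent_le hs1 (Nat.le_ceil a)
    have h3 : ((((j + 1 : ℕ) : ℝ)) / R) ^ a = (((j + 1 : ℕ) : ℝ)) ^ a * R ^ (-a) := by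
      rw [Real.div_rpow (by positivity) hR.le, Real.rpow_neg hR.le]; rfl
    calc _ ≤ (1 / 2 : ℝ) ^ j * (D * ((((j + 1 : ℕ) : ℝ)) / R) ^ a) := by gcongr
      _ ≤ (1 / 2 : ℝ) ^ j * (D * ((((j + 1 : ℕ) : ℝ)) ^ ⌈a⌉₊ * R ^ (-a))) := by
        rw [h3]; gcongr
      _ = _ := by ring
  refine (Finset.sum_le_sum h1).trans ?_
  rw [← Finset.mul_sum]
  have h4 := hsum.sum_le_tsum (Finset.Icc 1 ⌊ρ⌋₊) fun s _ => by positivity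
  calc _ ≤ 2 * D * R ^ (-a) * (∑' s : ℕ, (s : ℝ) ^ ⌈a⌉₊ * (1 / 2) ^ s) := by gcongr
    _ = _ := by ring

/-- A union bound over all small sets of clauses turns a moment bound into an asymptotic lower
bound for the resolution width. -/
theorem exists_tendsto_Pr_widthAtLeast (hβ : 2 < β) (hk : 0 < k) (m : ℕ → ℕ) {δ : ℝ} (hδ : 0 < δ)
    {R : ℕ → ℝ} (hR : Tendsto R atTop atTop) {K B a κ : ℝ} (hK : 0 < K) (hB : 0 < B) (ha : 0 < a)
    (hκ : 0 < κ)
    (h : ∀ᶠ n : ℕ in atTop, ∀ s : ℕ, 1 ≤ s → (s : ℝ) ≤ κ * R n → ∃ θ : ℝ, 0 < θ ∧ θ ≤ 1 ∧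
      (∀ S : Finset (Fin (m n)), S.card = s →
        onceMoment (drawProb β n) θ (S × Fin k) ≤ (K * θ) ^ (k * s)) ∧
      (m n : ℝ) / s * θ ^ ((k : ℝ) - δ) ≤ B * ((s : ℝ) / R n) ^ a) :
    ∃ C > (0 : ℝ), Tendsto (fun n : ℕ => Pr β n (m n) k {φ | widthAtLeast (C * R n) φ})
      atTop (nhds 1) := by
  have hβ1 : 1 < β := by linarith
  set D := Real.exp 1 * (2 * K) ^ k * B with hD
  have hD0 : 0 < D := by positivity
  set κ' := min κ ((1 / (2 * D)) ^ (1 / a)) with hκ'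
  have hκ'0 : 0 < κ' := lt_min hκ (by positivity)
  have hκ'D : D * κ' ^ a ≤ 1 / 2 := by
    have h1 : κ' ^ a ≤ ((1 / (2 * D)) ^ (1 / a)) ^ a := by
      gcongr
      exact min_le_right _ _
    rw [← Real.rpow_mul (by positivity), one_div_mul_cancel ha.ne', Real.rpow_one] at h1
    calc D * κ' ^ a ≤ D * (1 / (2 * D)) := by gcongr
      _ = 1 / 2 := by field_simp
  refine ⟨δ * κ' / 2, by positivity, ?_⟩
  set T := ∑' s : ℕ, (s : ℝ) ^ ⌈a⌉₊ * (1 / 2 : ℝ) ^ s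
  have hlow : Tendsto (fun n => 1 - 2 * D * T * R n ^ (-a)) atTop (nhds 1) := by
    have h1 : Tendsto (fun n => R n ^ (-a)) atTop (nhds 0) := (tendsto_rpow_neg_atTop ha).comp hR
    simpa using (h1.const_mul (2 * D * T)).const_sub 1
  refine tendsto_of_tendsto_of_tendsto_of_le_of_le' hlow tendsto_const_nhds ?_ ?_
  · filter_upwards [h, eventually_le_totalWt hβ (2 * (k : ℝ)), hR.eventually_gt_atTop 0,
      hR.eventually_ge_atTop (2 / κ')] with n hn hW hR0 hR2
    have hρ : 2 ≤ κ' * R n := by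
      rw [div_le_iff₀ hκ'0] at hR2
      linarith
    have hκR : κ' * R n ≤ κ * R n := by gcongr; exact min_le_left _ _
    have hmain : ∀ s : ℕ, ∃ v : ℝ, 0 ≤ v ∧ (1 ≤ s → (s : ℝ) ≤ κ' * R n →
        (∀ S : Finset (Fin (m n)), S.card = s →
          Pr β n (m n) k (poorBoundary δ n (m n) k S) ≤ v) ∧
        ((m n).choose s : ℝ) * v ≤ (D * ((s : ℝ) / R n) ^ a) ^ s) := by
      intro s
      by_cases hs : 1 ≤ s ∧ (s : ℝ) ≤ κ' * R n
      swap
      · exact ⟨0, le_rfl, fun h1 h2 => absurd ⟨h1, h2⟩ hs⟩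
      obtain ⟨θ, hθ, hθ1, hmom, hbd⟩ := hn s hs.1 (hs.2.trans hκR)
      refine ⟨2 ^ (k * s) * (K * θ) ^ (k * s) * θ ^ (-(δ * s)), by positivity, fun _ _ => ⟨?_, ?_⟩⟩
      · intro S hS
        have := Pr_poorBoundary_le (δ := δ) hβ1 hk hW hθ hθ1 S (hmom S hS)
        rwa [hS] at this
      · refine (choose_mul_moment_le hK hθ hs.1 hbd).trans (le_of_eq ?_)
        rw [hD]; ring
    choose f hf0 hf using hmain
    have h1 := one_sub_sum_le_Pr_widthAtLeast (m := m n) hβ1 hW hδ hρ hf0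
      fun S hS hSρ => (hf S.card hS.card_pos hSρ).1 S rfl
    have h2 : ∑ s ∈ Finset.Icc 1 ⌊κ' * R n⌋₊, ((m n).choose s : ℝ) * f s ≤
        ∑ s ∈ Finset.Icc 1 ⌊κ' * R n⌋₊, (D * ((s : ℝ) / R n) ^ a) ^ s := by
      refine Finset.sum_le_sum fun s hs => ?_
      rw [Finset.mem_Icc] at hs
      exact (hf s hs.1 ((Nat.le_floor_iff (by linarith)).1 hs.2)).2
    have h3 := sum_Icc_pow_self_le ha hD0 hR0 (ρ := κ' * R n)
      (by rwa [mul_div_assoc, div_self hR0.ne', mul_one]) (by positivity)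
    have h4 : δ * (κ' * R n) / 2 = δ * κ' / 2 * R n := by ring
    rw [h4] at h1
    linarith
  · filter_upwards [eventually_le_totalWt hβ (2 * (k : ℝ))] with n hW
    exact Pr_le_one hβ1 hW _

end UnionBound

section Weights

variable {β : ℝ} {n k : ℕ}

theorem sum_range_rpow_neg_le {b : ℝ} (hb0 : 0 ≤ b) (hb1 : b < 1) (N : ℕ) :
    ∑ i ∈ Finset.range N, ((i : ℝ) + 1) ^ (-b) ≤ (N : ℝ) ^ (1 - b) / (1 - b) := by
  have hb : 0 < 1 - b := by linarith
  induction N with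
  | zero => simp [Real.zero_rpow hb.ne']
  | succ N ih =>
    rw [Finset.sum_range_succ]
    have hN : (0 : ℝ) < (N : ℝ) + 1 := by positivity
    have h1 : (-1 : ℝ) ≤ -(1 / ((N : ℝ) + 1)) := by
      rw [neg_le_neg_iff, div_le_one hN]
      have : (0 : ℝ) ≤ N := by positivity
      linarith
    have h2 := rpow_one_add_le_one_add_mul_self h1 hb.le (by linarith)
    have h3 : (1 + -(1 / ((N : ℝ) + 1))) = N / ((N : ℝ) + 1) := by field_simp; ring
    rw [h3, Real.div_rpow (by positivity) hN.le, div_le_iff₀ (by positivity)] at h2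
    have h4 : ((N : ℝ) + 1) ^ (-b) = ((N : ℝ) + 1) ^ (1 - b) / ((N : ℝ) + 1) := by
      rw [show -b = 1 - b - 1 by ring, Real.rpow_sub_one hN.ne']
    push_cast
    rw [le_div_iff₀ hb] at ih ⊢
    rw [h4, add_mul]
    calc _ ≤ (N : ℝ) ^ (1 - b) + ((N : ℝ) + 1) ^ (1 - b) / ((N : ℝ) + 1) * (1 - b) := by gcongr
      _ ≤ (1 + (1 - b) * -(1 / ((N : ℝ) + 1))) * ((N : ℝ) + 1) ^ (1 - b) +
          ((N : ℝ) + 1) ^ (1 - b) / ((N : ℝ) + 1) * (1 - b) := by gcongr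
      _ = _ := by field_simp; ring

theorem sum_sq_drawProb_le (hβ : 2 < β) (hn : 1 ≤ n) {Z : ℝ}
    (hZ : ∑ i ∈ Finset.range n, ((i : ℝ) + 1) ^ (-(2 / (β - 1))) ≤ Z) :
    ∑ i, drawProb β n i ^ 2 ≤ Z * (n : ℝ) ^ (-(2 * (1 - 1 / (β - 1)))) := by
  have hn0 : (0 : ℝ) < n := by exact_mod_cast hn
  have hW := rpow_one_sub_le_totalWt hβ hn
  have hpos : 0 < (n : ℝ) ^ (1 - 1 / (β - 1)) := by positivity
  have h1 : ∑ i : Fin n, wt β i ^ 2 =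
      ∑ i ∈ Finset.range n, ((i : ℝ) + 1) ^ (-(2 / (β - 1))) := by
    rw [← Fin.sum_univ_eq_sum_range (fun i : ℕ => ((i : ℝ) + 1) ^ (-(2 / (β - 1))))]
    refine Finset.sum_congr rfl fun i _ => ?_
    unfold wt
    rw [← Real.rpow_mul_natCast (by positivity)]
    congr 1
    push_cast
    ring
  have h0 : 0 ≤ ∑ i : Fin n, wt β i ^ 2 := Finset.sum_nonneg fun i _ => sq_nonneg _
  unfold drawProb
  simp_rw [div_pow]
  rw [← Finset.sum_div, Real.rpow_neg hn0.le, ← div_eq_mul_inv]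
  have h2 : (n : ℝ) ^ (2 * (1 - 1 / (β - 1))) = ((n : ℝ) ^ (1 - 1 / (β - 1))) ^ 2 := by
    rw [← Real.rpow_mul_natCast hn0.le]
    congr 1
    push_cast
    ring
  rw [h2]
  rw [← h1] at hZ
  gcongr
  exact h0.trans hZ

theorem sum_subset_drawProb_le (hβ : 2 < β) (hn : 1 ≤ n) {N : ℕ} (hN : 1 ≤ N)
    (A : Finset (Fin n)) (hA : A.card ≤ N) :
    ∑ i ∈ A, drawProb β n i ≤
      (1 / (1 - 1 / (β - 1)) + 1) * ((N : ℝ) / n) ^ (1 - 1 / (β - 1)) := by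
  have hn0 : (0 : ℝ) < n := by exact_mod_cast hn
  have hN0 : (0 : ℝ) < N := by exact_mod_cast hN
  have hγ := rpow_exponent_pos hβ
  have hb0 : 0 ≤ 1 / (β - 1) := div_nonneg zero_le_one (by linarith)
  set b := 1 / (β - 1) with hb
  have hW : (n : ℝ) ^ (1 - b) ≤ totalWt β n := rpow_one_sub_le_totalWt hβ hn
  have hpos : 0 < (n : ℝ) ^ (1 - b) := by positivity
  have hwt : ∀ i : Fin n, wt β i = (((i : ℕ) : ℝ) + 1) ^ (-b) := by
    intro i
    rw [wt, hb, neg_div]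
  have h1 : ∀ i : Fin n, wt β i ≤ (N : ℝ) ^ (-b) +
      if (i : ℕ) < N then (((i : ℕ) : ℝ) + 1) ^ (-b) else 0 := by
    intro i
    rw [hwt]
    split_ifs with h
    · have : 0 ≤ (N : ℝ) ^ (-b) := by positivity
      linarith
    · rw [add_zero]
      refine Real.rpow_le_rpow_of_nonpos hN0 ?_ (by linarith)
      have : (N : ℝ) ≤ ((i : ℕ) : ℝ) := by exact_mod_cast not_lt.1 h
      linarith
  have h2 : ∑ i ∈ A, (if (i : ℕ) < N then (((i : ℕ) : ℝ) + 1) ^ (-b) else 0) ≤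
      ∑ i ∈ Finset.range N, ((i : ℝ) + 1) ^ (-b) := by
    calc _ ≤ ∑ i : Fin n, (if (i : ℕ) < N then (((i : ℕ) : ℝ) + 1) ^ (-b) else 0) :=
          Finset.sum_le_sum_of_subset_of_nonneg (Finset.subset_univ _)
            fun i _ _ => by split_ifs <;> positivity
      _ = ∑ i ∈ Finset.range n, (if i < N then ((i : ℝ) + 1) ^ (-b) else 0) :=
          Fin.sum_univ_eq_sum_range (fun i : ℕ => if i < N then ((i : ℝ) + 1) ^ (-b) else 0) n
      _ = ∑ i ∈ (Finset.range n).filter (· < N), ((i : ℝ) + 1) ^ (-b) := by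
          rw [Finset.sum_filter]
      _ ≤ _ := Finset.sum_le_sum_of_subset_of_nonneg
            (fun i hi => Finset.mem_range.2 (Finset.mem_filter.1 hi).2)
            fun i _ _ => by positivity
  have h3 : ∑ i ∈ A, wt β i ≤ (1 / (1 - b) + 1) * (N : ℝ) ^ (1 - b) := by
    calc _ ≤ ∑ i ∈ A, ((N : ℝ) ^ (-b) +
            if (i : ℕ) < N then (((i : ℕ) : ℝ) + 1) ^ (-b) else 0) :=
          Finset.sum_le_sum fun i _ => h1 i
      _ ≤ N * (N : ℝ) ^ (-b) + (N : ℝ) ^ (1 - b) / (1 - b) := by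
          rw [Finset.sum_add_distrib, Finset.sum_const, nsmul_eq_mul]
          refine add_le_add ?_ (h2.trans (sum_range_rpow_neg_le hb0 (by linarith) N))
          gcongr
      _ = _ := by
          rw [sub_eq_add_neg 1 b, Real.rpow_add hN0, Real.rpow_one]
          ring
  unfold drawProb
  rw [← Finset.sum_div, Real.div_rpow hN0.le hn0.le, ← mul_div_assoc]
  gcongr

end Weights

section Regimes

variable {β : ℝ} {k : ℕ}

/-- The width bound obtained from a bound `P` on the collision probability of two draws. -/
theorem exists_tendsto_of_collision (hβ : 2 < β) (hk : 0 < k) {m : ℕ → ℕ} {c : ℝ} (hc : 0 < c)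
    (hm : ∀ᶠ n : ℕ in atTop, c * (n : ℝ) ≤ (m n : ℝ)) {ε ε₁ : ℝ} (hε : 0 < ε) (hε₁ : 0 < ε₁)
    (hkε : (k : ℝ) - ε = 2 * (1 + ε₁)) {C : ℝ} (hC : 0 < C) {P : ℕ → ℝ}
    (hP : ∀ᶠ n : ℕ in atTop, ∑ i, drawProb β n i ^ 2 ≤ C * P n)
    (hnP : ∀ᶠ n : ℕ in atTop, 1 ≤ (n : ℝ) * P n)
    (hlim : Tendsto (fun n => (m n : ℝ) * P n ^ (1 + ε₁)) atTop (nhds 0)) :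
    ∃ C' > (0 : ℝ), Tendsto (fun n : ℕ => Pr β n (m n) k
      {φ | widthAtLeast (C' * ((m n : ℝ) * P n ^ (1 + ε₁)) ^ (-1 / ε₁)) φ}) atTop (nhds 1) := by
  set X : ℕ → ℝ := fun n => (m n : ℝ) * P n ^ (1 + ε₁) with hX
  have hbasic : ∀ᶠ n : ℕ in atTop, 0 < P n ∧ c ≤ (m n : ℝ) * P n ∧ 0 < X n := by
    filter_upwards [hm, hnP, eventually_ge_atTop 1] with n h1 h2 h3
    have hn0 : (0 : ℝ) < n := by exact_mod_cast h3
    have hP0 : 0 < P n := by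
      by_contra! hneg
      nlinarith
    have hm0 : (0 : ℝ) < m n := lt_of_lt_of_le (by positivity) h1
    refine ⟨hP0, ?_, by positivity⟩
    nlinarith
  have hexp : -1 / ε₁ < 0 := div_neg_of_neg_of_pos (by norm_num) hε₁
  have hR : Tendsto (fun n => X n ^ (-1 / ε₁)) atTop atTop :=
    (tendsto_rpow_neg_nhdsGT_zero hexp).comp
      (tendsto_nhdsWithin_iff.2 ⟨hlim, hbasic.mono fun n h => h.2.2⟩)
  have hk0 : (0 : ℝ) < k := by exact_mod_cast hk
  set c₂ : ℝ := (1 / c) ^ (1 / ε₁) with hc₂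
  have hc₂0 : 0 < c₂ := by positivity
  refine exists_tendsto_Pr_widthAtLeast hβ hk m hε hR (K := Real.exp 2)
    (B := (k * C) ^ (1 + ε₁)) (a := ε₁) (κ := 1 / (k * C * c₂)) (by positivity) (by positivity)
    hε₁ (by positivity) ?_
  filter_upwards [hbasic, hP, eventually_le_totalWt hβ 1] with n hn hPn hW s hs hsR
  obtain ⟨hP0, hcm, hX0⟩ := hn
  have hs0 : (0 : ℝ) < s := by exact_mod_cast hs
  have hm0 : (0 : ℝ) < m n := by
    by_contra! hneg
    nlinarith
  have hRpow : (X n ^ (-1 / ε₁)) ^ ε₁ = (X n)⁻¹ := by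
    rw [← Real.rpow_mul hX0.le, div_mul_cancel₀ _ hε₁.ne', Real.rpow_neg_one]
  have hRP : X n ^ (-1 / ε₁) * P n ≤ c₂ := by
    have h1 : (X n ^ (-1 / ε₁) * P n) ^ ε₁ ≤ 1 / c := by
      rw [Real.mul_rpow (by positivity) hP0.le, hRpow, hX]
      simp only
      rw [Real.rpow_add hP0, Real.rpow_one]
      have : (↑(m n) * (P n * P n ^ ε₁))⁻¹ * P n ^ ε₁ = 1 / (m n * P n) := by field_simp
      rw [this]
      gcongr
    calc X n ^ (-1 / ε₁) * P n = ((X n ^ (-1 / ε₁) * P n) ^ ε₁) ^ (1 / ε₁) := by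
          rw [← Real.rpow_mul (by positivity), mul_one_div_cancel hε₁.ne', Real.rpow_one]
      _ ≤ _ := by rw [hc₂]; gcongr
  set Q := k * s * (C * P n) with hQ
  have hQ0 : 0 < Q := by positivity
  have hQ1 : Q ≤ 1 := by
    calc Q = k * C * (s * P n) := by rw [hQ]; ring
      _ ≤ k * C * (1 / (k * C * c₂) * X n ^ (-1 / ε₁) * P n) := by gcongr
      _ = k * C * (1 / (k * C * c₂)) * (X n ^ (-1 / ε₁) * P n) := by ring
      _ ≤ k * C * (1 / (k * C * c₂)) * c₂ := by gcongr
      _ = 1 := by field_simp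
  refine ⟨Real.sqrt Q, Real.sqrt_pos.2 hQ0, Real.sqrt_le_one.2 hQ1, ?_, ?_⟩
  · intro S hS
    have hcard : Fintype.card (S × Fin k) = k * s := by simp [hS, mul_comm]
    have : Nonempty (S × Fin k) := by
      rw [← Fintype.card_pos_iff, hcard]
      positivity
    have := onceMoment_le_of_sum_sq (T := S × Fin k) (p := drawProb β n) drawProb_nonneg
      (sum_drawProb (by linarith)) (Real.sqrt_pos.2 hQ0) (by
        rw [Real.sq_sqrt hQ0.le, hcard, hQ]
        push_cast
        gcongr)
    rwa [hcard] at this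
  · rw [hkε, Real.sqrt_eq_rpow, ← Real.rpow_mul hQ0.le,
      show 1 / 2 * (2 * (1 + ε₁)) = 1 + ε₁ by ring,
      Real.div_rpow hs0.le (by positivity), hRpow, hX, hQ,
      show (k : ℝ) * s * (C * P n) = (k * C) * (s * P n) by ring,
      Real.mul_rpow (by positivity) (by positivity), Real.mul_rpow (by positivity) hP0.le]
    simp only
    rw [Real.rpow_add hs0, Real.rpow_one]
    apply le_of_eq
    field_simp

/-- The width bound obtained from the largest masses of sets of variables. -/
theorem exists_tendsto_of_subset_mass (hβ : 2 < β) (hk : 3 ≤ k) {m : ℕ → ℕ} {c : ℝ} (hc : 0 < c)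
    (hm : ∀ᶠ n : ℕ in atTop, c * (n : ℝ) ≤ (m n : ℝ)) {a : ℝ} (ha : 0 < a)
    (hak : a ≤ ((k : ℝ) / 2 - 1) * (1 - 1 / (β - 1)) - 1)
    (hlim : Tendsto (fun n : ℕ => (m n : ℝ) / n * (n : ℝ) ^ (-a)) atTop (nhds 0)) :
    ∃ C' > (0 : ℝ), Tendsto (fun n : ℕ => Pr β n (m n) k
      {φ | widthAtLeast (C' * ((n : ℝ) * ((m n : ℝ) / n) ^ (-1 / a))) φ}) atTop (nhds 1) := by
  have hk0 : (0 : ℝ) < k := by positivity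
  have hγ := rpow_exponent_pos hβ
  set γ := 1 - 1 / (β - 1) with hγdef
  have hexp : -1 / a < 0 := div_neg_of_neg_of_pos (by norm_num) ha
  have hbasic : ∀ᶠ n : ℕ in atTop, (0 : ℝ) < n ∧ c ≤ (m n : ℝ) / n := by
    filter_upwards [hm, eventually_ge_atTop 1] with n h1 h3
    have hn0 : (0 : ℝ) < n := by exact_mod_cast h3
    exact ⟨hn0, (le_div_iff₀ hn0).2 h1⟩
  have hRX : ∀ᶠ n : ℕ in atTop, ((m n : ℝ) / n * (n : ℝ) ^ (-a)) ^ (-1 / a) =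
      (n : ℝ) * ((m n : ℝ) / n) ^ (-1 / a) := by
    filter_upwards [hbasic] with n ⟨hn0, hcn⟩
    rw [Real.mul_rpow (by positivity) (by positivity), ← Real.rpow_mul hn0.le,
      show -a * (-1 / a) = 1 by field_simp, Real.rpow_one, mul_comm]
  have hR : Tendsto (fun n : ℕ => (n : ℝ) * ((m n : ℝ) / n) ^ (-1 / a)) atTop atTop := by
    refine ((tendsto_rpow_neg_nhdsGT_zero hexp).comp
      (tendsto_nhdsWithin_iff.2 ⟨hlim, hbasic.mono fun n h => ?_⟩)).congr' hRX
    have h1 : 0 < (m n : ℝ) / n := hc.trans_le h.2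
    have h2 := h.1
    show 0 < (m n : ℝ) / n * (n : ℝ) ^ (-a)
    positivity
  set C₀ : ℝ := 1 / γ + 1 with hC₀
  have hC₀1 : 1 ≤ C₀ := by
    have : 0 < 1 / γ := by positivity
    linarith
  have hC₀0 : 0 < C₀ := by linarith
  set c₂ : ℝ := c ^ (-1 / a) with hc₂
  have hc₂0 : 0 < c₂ := by positivity
  set η : ℝ := (1 / C₀) ^ (1 / γ) / k with hη
  have hη0 : 0 < η := by positivity
  have hη1 : η ≤ 1 := by
    rw [hη, div_le_one hk0]
    have h1 : (1 / C₀) ^ (1 / γ) ≤ 1 :=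
      Real.rpow_le_one (by positivity) ((div_le_one hC₀0).2 hC₀1) (by positivity)
    have h2 : (1 : ℝ) ≤ k := by exact_mod_cast (by omega : 1 ≤ k)
    linarith
  refine exists_tendsto_Pr_widthAtLeast hβ (by omega) m (δ := 2) two_pos hR (K := 2)
    (B := (C₀ * (k : ℝ) ^ γ) ^ ((k : ℝ) / 2 - 1)) (a := a) (κ := η / c₂) two_pos (by positivity)
    ha (by positivity) ?_
  filter_upwards [hbasic, eventually_le_totalWt hβ 1, eventually_ge_atTop 1]
    with n ⟨hn0, hcn⟩ hW hn1 s hs hsR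
  have hs0 : (0 : ℝ) < s := by exact_mod_cast hs
  set d : ℝ := (m n : ℝ) / n with hd
  have hd0 : 0 < d := hc.trans_le hcn
  have hsn : (s : ℝ) / n ≤ η := by
    rw [div_le_iff₀ hn0]
    calc (s : ℝ) ≤ η / c₂ * (n * d ^ (-1 / a)) := hsR
      _ ≤ η / c₂ * (n * c₂) := by
        have : d ^ (-1 / a) ≤ c₂ := Real.rpow_le_rpow_of_nonpos hc hcn hexp.le
        gcongr
      _ = η * n := by field_simp
  have hsn0 : 0 < (s : ℝ) / n := by positivity
  set q : ℝ := C₀ * (((k * s : ℕ) : ℝ) / n) ^ γ with hq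
  have hq' : q = C₀ * (k : ℝ) ^ γ * ((s : ℝ) / n) ^ γ := by
    rw [hq, mul_assoc, ← Real.mul_rpow hk0.le hsn0.le]
    push_cast
    rw [mul_div_assoc]
  have hq0 : 0 < q := by rw [hq']; positivity
  have hq1 : q ≤ 1 := by
    have h1 : ((s : ℝ) / n) ^ γ ≤ η ^ γ := by gcongr
    have h2 : (k : ℝ) ^ γ * η ^ γ = 1 / C₀ := by
      rw [← Real.mul_rpow hk0.le hη0.le, hη, mul_div_cancel₀ _ hk0.ne',
        ← Real.rpow_mul (by positivity), one_div_mul_cancel hγ.ne', Real.rpow_one]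
    calc q ≤ C₀ * (k : ℝ) ^ γ * η ^ γ := by rw [hq']; gcongr
      _ = C₀ * (1 / C₀) := by rw [mul_assoc, h2]
      _ = 1 := by field_simp
  refine ⟨Real.sqrt q, Real.sqrt_pos.2 hq0, Real.sqrt_le_one.2 hq1, ?_, ?_⟩
  · intro S hS
    have hcard : Fintype.card (S × Fin k) = k * s := by simp [hS, mul_comm]
    have := onceMoment_le_of_sum_subset (T := S × Fin k) (p := drawProb β n) drawProb_nonneg
      (sum_drawProb (by linarith)) (Real.sqrt_pos.2 hq0) (Real.sqrt_le_one.2 hq1) (fun A hA => by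
        rw [Real.sq_sqrt hq0.le]
        rw [hcard] at hA
        exact sum_subset_drawProb_le hβ hn1 (Nat.mul_pos (by lia) hs) A hA)
    rwa [hcard] at this
  · have hXR : ((s : ℝ) / (n * d ^ (-1 / a))) ^ a = d * ((s : ℝ) / n) ^ a := by
      rw [← div_div, Real.div_rpow hsn0.le (by positivity), ← Real.rpow_mul hd0.le,
        div_mul_cancel₀ _ ha.ne', Real.rpow_neg_one, div_inv_eq_mul, mul_comm]
    have hk1 : (0 : ℝ) ≤ (k : ℝ) / 2 - 1 := by
      have : (3 : ℝ) ≤ k := by exact_mod_cast hk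
      linarith
    rw [hXR, Real.sqrt_eq_rpow, ← Real.rpow_mul hq0.le,
      show 1 / 2 * ((k : ℝ) - 2) = k / 2 - 1 by ring, hq',
      Real.mul_rpow (by positivity) (by positivity), ← Real.rpow_mul hsn0.le]
    have h1 : ((s : ℝ) / n) ^ (γ * ((k : ℝ) / 2 - 1)) ≤ ((s : ℝ) / n) ^ (a + 1) :=
      Real.rpow_le_rpow_of_exponent_ge hsn0 (hsn.trans hη1) (by linarith)
    calc _ ≤ (m n : ℝ) / s * ((C₀ * (k : ℝ) ^ γ) ^ ((k : ℝ) / 2 - 1) *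
          ((s : ℝ) / n) ^ (a + 1)) := by gcongr
      _ = _ := by
        rw [Real.rpow_add_one hsn0.ne', hd]
        field_simp

end Regimes

theorem exists_tendsto_of_lt_three {β ε ε₁ ε₂ c : ℝ} {k : ℕ} {m : ℕ → ℕ} (hβ : 2 < β) (hβ3 : β < 3)
    (hk : 0 < k) (hc : 0 < c) (hm : ∀ᶠ n : ℕ in atTop, c * (n : ℝ) ≤ m n)
    (hε : 0 < ε) (hε₁ : 0 < ε₁) (hkε : (k : ℝ) - ε = 2 * (1 + ε₁))
    (hε₂ : 1 + ε₂ = 2 * (1 - 1 / (β - 1)) * (1 + ε₁))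
    (hlim : Tendsto (fun n : ℕ => (m n : ℝ) / n / (n : ℝ) ^ ε₂) atTop (nhds 0)) :
    ∃ C > (0 : ℝ), Tendsto (fun n : ℕ => Pr β n (m n) k
      {φ | widthAtLeast (C * ((n : ℝ) ^ (ε₂ / ε₁) * ((m n : ℝ) / n) ^ (-1 / ε₁))) φ})
      atTop (nhds 1) := by
  set γ := 1 - 1 / (β - 1) with hγ
  have hexp : 1 < 2 / (β - 1) := by rw [lt_div_iff₀ (by linarith)]; linarith
  have hγ2 : 2 * γ ≤ 1 := by
    have : 2 / (β - 1) = 2 * (1 / (β - 1)) := by ring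
    rw [hγ]; linarith
  have hsum : Summable fun i : ℕ => ((i : ℝ) + 1) ^ (-(2 / (β - 1))) := by
    have := (summable_nat_add_iff 1).2 (Real.summable_nat_rpow.2 (neg_lt_neg hexp))
    simpa using this
  have hnn : ∀ i : ℕ, 0 ≤ ((i : ℝ) + 1) ^ (-(2 / (β - 1))) := fun i => by positivity
  have hR : ∀ᶠ n : ℕ in atTop, (m n : ℝ) * ((n : ℝ) ^ (-(2 * γ))) ^ (1 + ε₁)
      = (m n : ℝ) / n / (n : ℝ) ^ ε₂ := by
    filter_upwards [eventually_ge_atTop 1] with n hn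
    have hn0 : (0 : ℝ) < n := by exact_mod_cast hn
    rw [← Real.rpow_mul hn0.le, neg_mul, ← hε₂, Real.rpow_neg hn0.le, Real.rpow_add hn0,
      Real.rpow_one, div_div, div_eq_mul_inv]
  obtain ⟨C', hC', h⟩ := exists_tendsto_of_collision (β := β) (k := k) (m := m)
    (P := fun n => (n : ℝ) ^ (-(2 * γ)))
    (C := (∑' i : ℕ, ((i : ℝ) + 1) ^ (-(2 / (β - 1)))) + 1) hβ hk hc hm hε hε₁ hkε
    (add_pos_of_nonneg_of_pos (tsum_nonneg hnn) one_pos)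
    (by
      filter_upwards [eventually_ge_atTop 1] with n hn
      exact sum_sq_drawProb_le hβ hn
        ((hsum.sum_le_tsum _ fun i _ => hnn i).trans (by linarith)))
    (by
      filter_upwards [eventually_ge_atTop 1] with n hn
      have hn1 : (1 : ℝ) ≤ n := by exact_mod_cast hn
      calc (1 : ℝ) ≤ (n : ℝ) ^ (1 + -(2 * γ)) := Real.one_le_rpow hn1 (by linarith)
        _ = _ := by rw [Real.rpow_add (by linarith), Real.rpow_one])
    (hlim.congr' (hR.mono fun _ h => h.symm))
  refine ⟨C', hC', h.congr' ?_⟩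
  filter_upwards [hR, eventually_ge_atTop 1] with n hRn hn
  have hn0 : (0 : ℝ) < n := by exact_mod_cast hn
  have : ((m n : ℝ) / n / (n : ℝ) ^ ε₂) ^ (-1 / ε₁)
      = (n : ℝ) ^ (ε₂ / ε₁) * ((m n : ℝ) / n) ^ (-1 / ε₁) := by
    rw [div_eq_mul_inv _ ((n : ℝ) ^ ε₂), Real.mul_rpow (by positivity) (by positivity),
      ← Real.rpow_neg hn0.le, ← Real.rpow_mul hn0.le, mul_comm]
    congr 2
    ring
  simp only [hRn, this]

theorem exists_tendsto_of_eq_three {ε ε₁ c : ℝ} {k : ℕ} {m : ℕ → ℕ}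
    (hk : 0 < k) (hc : 0 < c) (hm : ∀ᶠ n : ℕ in atTop, c * (n : ℝ) ≤ m n)
    (hε : 0 < ε) (hε₁ : 0 < ε₁) (hkε : (k : ℝ) - ε = 2 * (1 + ε₁))
    (hlim : Tendsto (fun n : ℕ => (m n : ℝ) / n / ((n : ℝ) ^ ε₁ / Real.log n ^ (1 + ε₁)))
      atTop (nhds 0)) :
    ∃ C > (0 : ℝ), Tendsto (fun n : ℕ => Pr 3 n (m n) k
      {φ | widthAtLeast
        (C * ((n : ℝ) * ((m n : ℝ) / n) ^ (-1 / ε₁) / Real.log n ^ (1 + 1 / ε₁))) φ})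
      atTop (nhds 1) := by
  have hlog : ∀ᶠ n : ℕ in atTop, 1 ≤ Real.log n :=
    (Real.tendsto_log_atTop.comp tendsto_natCast_atTop_atTop).eventually_ge_atTop 1
  have hR : ∀ᶠ n : ℕ in atTop, (m n : ℝ) * (Real.log n / n) ^ (1 + ε₁)
      = (m n : ℝ) / n / ((n : ℝ) ^ ε₁ / Real.log n ^ (1 + ε₁)) := by
    filter_upwards [eventually_ge_atTop 1, hlog] with n hn hl
    have hn0 : (0 : ℝ) < n := by exact_mod_cast hn
    rw [Real.div_rpow (by linarith) hn0.le, Real.rpow_add hn0 1 ε₁, Real.rpow_one]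
    field_simp
  obtain ⟨C', hC', h⟩ := exists_tendsto_of_collision (β := 3) (k := k) (m := m)
    (P := fun n => Real.log n / n) (C := 2) (by norm_num) hk hc hm hε hε₁ hkε (by norm_num)
    (by
      filter_upwards [eventually_ge_atTop 1, hlog] with n hn hl
      refine (sum_sq_drawProb_le (Z := 2 * Real.log n) (by norm_num) hn ?_).trans_eq ?_
      · calc ∑ i ∈ Finset.range n, ((i : ℝ) + 1) ^ (-(2 / ((3 : ℝ) - 1)))
            = ((harmonic n : ℚ) : ℝ) := by
              rw [harmonic]; push_cast
              refine Finset.sum_congr rfl fun i _ => ?_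
              norm_num [Real.rpow_neg_one]
          _ ≤ 1 + Real.log n := harmonic_le_one_add_log n
          _ ≤ _ := by linarith
      · norm_num [Real.rpow_neg_one]
        ring)
    (by
      filter_upwards [eventually_ge_atTop 1, hlog] with n hn hl
      have hn0 : (0 : ℝ) < n := by exact_mod_cast hn
      rwa [mul_div_cancel₀ _ hn0.ne'])
    (hlim.congr' (hR.mono fun _ h => h.symm))
  refine ⟨C', hC', h.congr' ?_⟩
  filter_upwards [hR, eventually_ge_atTop 1, hlog] with n hRn hn hl
  have hn0 : (0 : ℝ) < n := by exact_mod_cast hn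
  have hl0 : 0 < Real.log n := by linarith
  have : ((m n : ℝ) / n / ((n : ℝ) ^ ε₁ / Real.log n ^ (1 + ε₁))) ^ (-1 / ε₁)
      = (n : ℝ) * ((m n : ℝ) / n) ^ (-1 / ε₁) / Real.log n ^ (1 + 1 / ε₁) := by
    have h1 : ((n : ℝ) ^ ε₁) ^ (-1 / ε₁) = (n : ℝ)⁻¹ := by
      rw [← Real.rpow_mul hn0.le, mul_div_cancel₀ _ hε₁.ne', Real.rpow_neg_one]
    have h2 : (Real.log n ^ (1 + ε₁)) ^ (-1 / ε₁) = (Real.log n ^ (1 + 1 / ε₁))⁻¹ := by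
      rw [← Real.rpow_mul hl0.le, ← Real.rpow_neg hl0.le]
      congr 1
      field_simp
      ring
    rw [Real.div_rpow (x := (m n : ℝ) / n) (by positivity) (by positivity),
      Real.div_rpow (x := (n : ℝ) ^ ε₁) (by positivity) (by positivity), h1, h2]
    field_simp
  simp only [hRn, this]

theorem exists_tendsto_of_three_lt {β ε ε₁ c : ℝ} {k : ℕ} {m : ℕ → ℕ} (hβ : 3 < β)
    (hk : 0 < k) (hc : 0 < c) (hm : ∀ᶠ n : ℕ in atTop, c * (n : ℝ) ≤ m n)
    (hε : 0 < ε) (hε₁ : 0 < ε₁) (hkε : (k : ℝ) - ε = 2 * (1 + ε₁))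
    (hlim : Tendsto (fun n : ℕ => (m n : ℝ) / n / (n : ℝ) ^ ε₁) atTop (nhds 0)) :
    ∃ C > (0 : ℝ), Tendsto (fun n : ℕ => Pr β n (m n) k
      {φ | widthAtLeast (C * ((n : ℝ) * ((m n : ℝ) / n) ^ (-1 / ε₁))) φ}) atTop (nhds 1) := by
  have hb0 : 0 ≤ 2 / (β - 1) := div_nonneg zero_le_two (by linarith)
  have hb1 : 2 / (β - 1) < 1 := by rw [div_lt_one (by linarith)]; linarith
  have hR : ∀ᶠ n : ℕ in atTop, (m n : ℝ) * ((n : ℝ)⁻¹) ^ (1 + ε₁)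
      = (m n : ℝ) / n / (n : ℝ) ^ ε₁ := by
    filter_upwards [eventually_ge_atTop 1] with n hn
    have hn0 : (0 : ℝ) < n := by exact_mod_cast hn
    rw [Real.inv_rpow hn0.le, Real.rpow_add hn0, Real.rpow_one, div_div, div_eq_mul_inv]
  obtain ⟨C', hC', h⟩ := exists_tendsto_of_collision (β := β) (k := k) (m := m)
    (P := fun n => (n : ℝ)⁻¹) (C := (1 - 2 / (β - 1))⁻¹) (by linarith) hk hc hm hε hε₁ hkε
    (inv_pos.2 (by linarith))
    (by
      filter_upwards [eventually_ge_atTop 1] with n hn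
      have hn0 : (0 : ℝ) < n := by exact_mod_cast hn
      refine (sum_sq_drawProb_le (by linarith) hn
        (sum_range_rpow_neg_le hb0 hb1 n)).trans_eq ?_
      rw [div_mul_eq_mul_div, ← Real.rpow_add hn0,
        show 1 - 2 / (β - 1) + -(2 * (1 - 1 / (β - 1))) = -1 by ring, Real.rpow_neg_one,
        div_eq_inv_mul])
    (by
      filter_upwards [eventually_ge_atTop 1] with n hn
      have hn0 : (0 : ℝ) < n := by exact_mod_cast hn
      rw [mul_inv_cancel₀ hn0.ne'])
    (hlim.congr' (hR.mono fun _ h => h.symm))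
  refine ⟨C', hC', h.congr' ?_⟩
  filter_upwards [hR, eventually_ge_atTop 1] with n hRn hn
  have hn0 : (0 : ℝ) < n := by exact_mod_cast hn
  have : ((m n : ℝ) / n / (n : ℝ) ^ ε₁) ^ (-1 / ε₁)
      = (n : ℝ) * ((m n : ℝ) / n) ^ (-1 / ε₁) := by
    rw [Real.div_rpow (by positivity) (by positivity), ← Real.rpow_mul hn0.le,
      mul_div_cancel₀ _ hε₁.ne', Real.rpow_neg_one, div_inv_eq_mul, mul_comm]
  simp only [hRn, this]

end PLSAT

open PLSAT in
/-- **Theorem 1 (power-law random k-SAT resolution width lower bounds).**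
Let `Φ` be a random power-law `k`-SAT formula with `n` variables, `m ∈ Ω(n)` clauses,
`k ≥ 3`, power-law exponent `β > (2k-1)/(k-1)`, and density `Δ = m/n` large enough so
that `Φ` is unsatisfiable with at least constant probability.  Then asymptotically
almost surely the resolution width `w` of `Φ` satisfies the four stated lower bounds. -/
theorem power_law_resolution_width
    (k : ℕ) (hk : 3 ≤ k) (β : ℝ)
    (hβ : (2 * (k : ℝ) - 1) / ((k : ℝ) - 1) < β)
    (m : ℕ → ℕ)
    (hm : ∃ c > (0 : ℝ), ∀ᶠ n : ℕ in atTop, c * (n : ℝ) ≤ (m n : ℝ))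
    (Δ : ℕ → ℝ) (hΔ : ∀ n : ℕ, Δ n = (m n : ℝ) / (n : ℝ))
    (hunsat : ∃ c > (0 : ℝ), ∀ᶠ n : ℕ in atTop,
      c ≤ Pr β n (m n) k {φ | Unsat φ})
    (ε ε₁ ε₂ ε₃ : ℝ) (hε : 0 < ε)
    (hε₁def : ε₁ = ((k : ℝ) - ε) / 2 - 1) (hε₁ : 0 < ε₁)
    (hε₂def : ε₂ = ((k : ℝ) - ε) * (β - 2) / (β - 1) - 1) (hε₂ : 0 < ε₂)
    (hε₃ : 0 < ε₃) (hε₃ub : ε₃ < ((k : ℝ) / 2 - 1) * (β - 2) / (β - 1) - 1) :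
    -- (i)
    ((β < 3 ∧ (Δ =o[atTop] fun n : ℕ => (n : ℝ) ^ ε₂)) →
      ∃ C > (0 : ℝ), Tendsto (fun n : ℕ => Pr β n (m n) k
          {φ | widthAtLeast (C * ((n : ℝ) ^ (ε₂ / ε₁) * Δ n ^ (-1 / ε₁))) φ})
        atTop (nhds 1)) ∧
    -- (ii)
    ((β = 3 ∧ (Δ =o[atTop] fun n : ℕ => (n : ℝ) ^ ε₁ / Real.log n ^ (1 + ε₁))) →
      ∃ C > (0 : ℝ), Tendsto (fun n : ℕ => Pr β n (m n) k
          {φ | widthAtLeast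
            (C * ((n : ℝ) * Δ n ^ (-1 / ε₁) / Real.log n ^ (1 + 1 / ε₁))) φ})
        atTop (nhds 1)) ∧
    -- (iii)
    ((3 < β ∧ (Δ =o[atTop] fun n : ℕ => (n : ℝ) ^ ε₁)) →
      ∃ C > (0 : ℝ), Tendsto (fun n : ℕ => Pr β n (m n) k
          {φ | widthAtLeast (C * ((n : ℝ) * Δ n ^ (-1 / ε₁))) φ})
        atTop (nhds 1)) ∧
    -- (iv)
    (((2 * (k : ℝ) - 2) / ((k : ℝ) - 2) < β ∧
        (Δ =o[atTop] fun n : ℕ => (n : ℝ) ^ ε₃ / Real.log n ^ ε₃)) →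
      ∃ C > (0 : ℝ), Tendsto (fun n : ℕ => Pr β n (m n) k
          {φ | widthAtLeast (C * ((n : ℝ) * Δ n ^ (-1 / ε₃))) φ})
        atTop (nhds 1)) := by
  obtain rfl : Δ = fun n => (m n : ℝ) / n := funext hΔ
  obtain ⟨c, hc, hm⟩ := hm
  have hk3 : (3 : ℝ) ≤ k := by exact_mod_cast hk
  have hβ2 : 2 < β := by
    refine lt_of_lt_of_le ?_ hβ.le
    rw [lt_div_iff₀ (by linarith)]
    linarith
  have hβ1 : β - 1 ≠ 0 := by linarith
  have hkε : (k : ℝ) - ε = 2 * (1 + ε₁) := by linarith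
  have hγ : 1 - 1 / (β - 1) = (β - 2) / (β - 1) := by field_simp; ring
  refine ⟨fun ⟨h3, ho⟩ => ?_, fun ⟨h3, ho⟩ => ?_, fun ⟨h3, ho⟩ => ?_, fun ⟨_, ho⟩ => ?_⟩
  · refine exists_tendsto_of_lt_three hβ2 h3 (by lia) hc hm hε hε₁ hkε ?_
      ho.tendsto_div_nhds_zero
    rw [hε₂def, hγ, hkε]
    ring
  · subst h3
    exact exists_tendsto_of_eq_three (by lia) hc hm hε hε₁ hkε ho.tendsto_div_nhds_zero
  · exact exists_tendsto_of_three_lt h3 (by lia) hc hm hε hε₁ hkε ho.tendsto_div_nhds_zero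
  · refine exists_tendsto_of_subset_mass hβ2 hk hc hm hε₃ ?_ ?_
    · rw [hγ, ← mul_div_assoc]
      exact hε₃ub.le
    · have hlog : ∀ᶠ n : ℕ in atTop, 1 ≤ Real.log n :=
        (Real.tendsto_log_atTop.comp tendsto_natCast_atTop_atTop).eventually_ge_atTop 1
      refine squeeze_zero' (Eventually.of_forall fun n => by positivity) ?_
        ho.tendsto_div_nhds_zero
      filter_upwards [hlog] with n hl
      rw [Real.rpow_neg n.cast_nonneg, ← div_eq_mul_inv, div_div_eq_mul_div]
      gcongr
      exact le_mul_of_one_le_right (by positivity) (Real.one_le_rpow hl hε₃.le)
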